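/- arXiv:1204.2290 — 7 statements merged into one kernel-verified Lean document; each statement's English description precedes it below -/
import Mathlib

section
/- For every n ≥ 2 and every 1 ≤ m < n, one has σ_n ≤ √2 · γ^{−1} · d_m^{(n−m)/n}; in particular σ_n ≤ √2 · γ^{−1} · min_{1 ≤ m < n} d_m^{(n−m)/n}. -/
open Metric Submodule

open InnerProductSpace in
theorem infDist_span_Iio_le_norm_gramSchmidt {E ι : Type*} [NormedAddCommGroup E]
    [InnerProductSpace ℝ E] [LinearOrder ι] [LocallyFiniteOrderBot ι] [WellFoundedLT ι]
    (f : ι → E) (i : ι) :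
    infDist (f i) (span ℝ (f '' Set.Iio i) : Submodule ℝ E) ≤ ‖gramSchmidt ℝ f i‖ := by
  have hmem : f i - gramSchmidt ℝ f i ∈ span ℝ (f '' Set.Iio i) := by
    rw [gramSchmidt_def, sub_sub_cancel, ← span_gramSchmidt_Iio ℝ f i]
    refine Submodule.sum_mem _ fun j hj => ?_
    rw [starProjection_singleton]
    exact Submodule.smul_mem _ _ (subset_span ⟨j, by simpa using hj, rfl⟩)
  simpa [dist_eq_norm] using infDist_le_dist_of_mem (x := f i) (SetLike.mem_coe.2 hmem)

open InnerProductSpace in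
theorem linearIndependent_of_gramSchmidt_ne_zero {E ι : Type*} [NormedAddCommGroup E]
    [InnerProductSpace ℝ E] [LinearOrder ι] [LocallyFiniteOrderBot ι] [WellFoundedLT ι]
    [Fintype ι] {f : ι → E} (h : ∀ i, gramSchmidt ℝ f i ≠ 0) : LinearIndependent ℝ f := by
  have hg : LinearIndependent ℝ (gramSchmidt ℝ f) :=
    linearIndependent_of_ne_zero_of_inner_eq_zero h (gramSchmidt_pairwise_orthogonal ℝ f)
  rw [linearIndependent_iff_card_eq_finrank_span] at hg ⊢
  rw [hg, Set.finrank, Set.finrank, span_gramSchmidt]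

open InnerProductSpace in
theorem norm_gramSchmidt_le_abs_inner {E ι : Type*} [NormedAddCommGroup E]
    [InnerProductSpace ℝ E] [FiniteDimensional ℝ E] [LinearOrder ι] [LocallyFiniteOrderBot ι]
    [WellFoundedLT ι] [Fintype ι] (h : Module.finrank ℝ E = Fintype.card ι) (f : ι → E) (i : ι) :
    ‖gramSchmidt ℝ f i‖ ≤ |inner ℝ (gramSchmidtOrthonormalBasis h f i) (f i)| := by
  rcases eq_or_ne (gramSchmidt ℝ f i) 0 with h0 | h0
  · simp [h0]
  have hn : ‖gramSchmidt ℝ f i‖ ≠ 0 := norm_ne_zero_iff.2 h0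
  have hb : gramSchmidtNormed ℝ f i ≠ 0 := by
    simp [gramSchmidtNormed, h0]
  have hinner : inner ℝ (gramSchmidt ℝ f i) (f i) = ‖gramSchmidt ℝ f i‖ ^ 2 := by
    conv_lhs => rw [gramSchmidt_def' ℝ f i]
    rw [inner_add_right, inner_sum, Finset.sum_eq_zero, add_zero, real_inner_self_eq_norm_sq]
    intro j hj
    rw [starProjection_singleton, inner_smul_right,
      gramSchmidt_orthogonal ℝ f (Finset.mem_Iio.1 hj).ne', mul_zero]
  rw [gramSchmidtOrthonormalBasis_apply h hb, gramSchmidtNormed, inner_smul_left, hinner]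
  refine le_of_eq ?_
  simp only [RCLike.ofReal_real_eq_id, id_eq, map_inv₀, conj_trivial]
  rw [abs_of_nonneg (by positivity)]
  field_simp

/-- Hadamard's inequality. -/
theorem OrthonormalBasis.abs_det_le_prod_norm {E : Type*} [NormedAddCommGroup E]
    [InnerProductSpace ℝ E] {n : ℕ} (b : OrthonormalBasis (Fin n) ℝ E) (v : Fin n → E) :
    |b.toBasis.det v| ≤ ∏ i, ‖v i‖ := by
  have : Fact (Module.finrank ℝ E = n) :=
    ⟨by simpa using Module.finrank_eq_card_basis b.toBasis⟩
  rw [← b.toBasis.orientation.volumeForm_robust' b v]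
  exact b.toBasis.orientation.abs_volumeForm_apply_le v

theorem det_smul_starProjection_add {E : Type*} [NormedAddCommGroup E] [InnerProductSpace ℝ E]
    [FiniteDimensional ℝ E] (K : Submodule ℝ E) (a : ℝ) :
    LinearMap.det (a • (K.starProjection : E →ₗ[ℝ] E) + (Kᗮ.starProjection : E →ₗ[ℝ] E)) =
      a ^ Module.finrank ℝ K := by
  let e := prodEquivOfIsCompl K Kᗮ K.isCompl_orthogonal
  have hconj : a • (K.starProjection : E →ₗ[ℝ] E) + (Kᗮ.starProjection : E →ₗ[ℝ] E) =
      e.toLinearMap ∘ₗ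
        LinearMap.prodMap (a • LinearMap.id : K →ₗ[ℝ] K) (LinearMap.id : Kᗮ →ₗ[ℝ] Kᗮ) ∘ₗ
          e.symm.toLinearMap := by
    rw [← LinearMap.comp_assoc, LinearEquiv.eq_comp_toLinearMap_symm]
    refine LinearMap.ext fun p => ?_
    obtain ⟨⟨x, hx⟩, ⟨y, hy⟩⟩ := p
    have h1 : K.starProjection x = x := starProjection_eq_self_iff.2 hx
    have h2 : K.starProjection y = 0 := (starProjection_apply_eq_zero_iff K).2 hy
    simp [e, h1, h2]
  rw [hconj, LinearMap.det_conj, LinearMap.det_prodMap]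
  simp

theorem OrthonormalBasis.abs_det_le_of_norm_starProjection_le {E : Type*} [NormedAddCommGroup E]
    [InnerProductSpace ℝ E] [FiniteDimensional ℝ E] {n : ℕ} (b : OrthonormalBasis (Fin n) ℝ E)
    (K : Submodule ℝ E) {f : Fin n → E} {s : ℝ} (hs : 0 < s) (hf : ∀ i, ‖f i‖ ≤ 1)
    (hK : ∀ i, ‖K.starProjection (f i)‖ ≤ s) :
    |b.toBasis.det f| ≤ √2 ^ n * s ^ Module.finrank ℝ K := by
  set T : E →ₗ[ℝ] E := s⁻¹ • (K.starProjection : E →ₗ[ℝ] E) + (Kᗮ.starProjection : E →ₗ[ℝ] E)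
    with hT
  have hnorm : ∀ i, ‖T (f i)‖ ≤ √2 := by
    intro i
    refine Real.le_sqrt_of_sq_le ?_
    have horth : inner ℝ (s⁻¹ • K.starProjection (f i)) (Kᗮ.starProjection (f i)) = 0 :=
      K.inner_right_of_mem_orthogonal (K.smul_mem _ (K.starProjection_apply_mem _))
        (Kᗮ.starProjection_apply_mem _)
    have h1 : ‖T (f i)‖ ^ 2 = ‖s⁻¹ • K.starProjection (f i)‖ ^ 2
        + ‖Kᗮ.starProjection (f i)‖ ^ 2 := by
      simpa [hT, sq] using norm_add_sq_eq_norm_sq_add_norm_sq_of_inner_eq_zero _ _ horth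
    have h2 : ‖s⁻¹ • K.starProjection (f i)‖ ≤ 1 := by
      rw [norm_smul, norm_inv, Real.norm_of_nonneg hs.le, inv_mul_le_one₀ hs]
      exact hK i
    have h3 : ‖Kᗮ.starProjection (f i)‖ ≤ 1 := (Kᗮ.norm_starProjection_apply_le _).trans (hf i)
    rw [h1]
    nlinarith [norm_nonneg (s⁻¹ • K.starProjection (f i)), norm_nonneg (Kᗮ.starProjection (f i))]
  have hdet : |b.toBasis.det (T ∘ f)| = (s ^ Module.finrank ℝ K)⁻¹ * |b.toBasis.det f| := by
    rw [b.toBasis.det_comp, hT, det_smul_starProjection_add, abs_mul, inv_pow,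
      abs_of_pos (by positivity)]
  have hle : |b.toBasis.det (T ∘ f)| ≤ √2 ^ n :=
    (b.abs_det_le_prod_norm _).trans <| by
      simpa using Finset.prod_le_prod (s := Finset.univ) (fun i _ => norm_nonneg (T (f i)))
        fun i _ => hnorm i
  rwa [hdet, inv_mul_le_iff₀ (by positivity), mul_comm] at hle

theorem norm_le_infDist_of_mem_orthogonal {E : Type*} [NormedAddCommGroup E]
    [InnerProductSpace ℝ E] {Y : Submodule ℝ E} {p x : E} (hp : p ∈ Yᗮ)
    (hpx : inner ℝ p x = ‖p‖ ^ 2) : ‖p‖ ≤ infDist x Y := by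
  refine (le_infDist ⟨0, Y.zero_mem⟩).2 fun {y} hy => ?_
  have hpy : inner ℝ p (x - y) = ‖p‖ ^ 2 := by
    rw [inner_sub_right, hpx, Y.inner_left_of_mem_orthogonal hy hp, sub_zero]
  have hle : ‖p‖ * ‖p‖ ≤ ‖p‖ * dist x y := by
    rw [dist_eq_norm, ← sq, ← hpy]
    exact real_inner_le_norm p (x - y)
  rcases (norm_nonneg p).eq_or_lt with h0 | h0
  · rw [← h0]; exact dist_nonneg
  · exact le_of_mul_le_mul_left hle h0

open InnerProductSpace in
theorem prod_infDist_span_Iio_le {H : Type*} [NormedAddCommGroup H] [InnerProductSpace ℝ H]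
    {n m : ℕ} {f : Fin n → H} {s : ℝ} (hs : 0 < s) (hs1 : s ≤ 1) (hf : ∀ i, ‖f i‖ ≤ 1)
    (Y : Submodule ℝ H) [FiniteDimensional ℝ Y] (hYm : Module.finrank ℝ Y ≤ m)
    (hY : ∀ i, infDist (f i) Y ≤ s) :
    ∏ i, infDist (f i) (span ℝ (f '' Set.Iio i) : Submodule ℝ H) ≤ √2 ^ n * s ^ (n - m) := by
  by_cases h0 : ∃ i, gramSchmidt ℝ f i = 0
  · obtain ⟨i, hi⟩ := h0
    have hle := infDist_span_Iio_le_norm_gramSchmidt f i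
    rw [hi, norm_zero] at hle
    rw [Finset.prod_eq_zero (Finset.mem_univ i) (le_antisymm hle infDist_nonneg)]
    positivity
  have hli : LinearIndependent ℝ f := linearIndependent_of_gramSchmidt_ne_zero (not_exists.1 h0)
  let W : Submodule ℝ H := span ℝ (Set.range f)
  have : FiniteDimensional ℝ W := FiniteDimensional.span_of_finite ℝ (Set.finite_range f)
  have hW : Module.finrank ℝ W = Fintype.card (Fin n) := finrank_span_eq_card hli
  let g : Fin n → W := fun i => ⟨f i, subset_span ⟨i, rfl⟩⟩
  let b := gramSchmidtOrthonormalBasis hW g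
  let P : W →ₗ[ℝ] Y := (Y.orthogonalProjectionOnto : H →ₗ[ℝ] Y) ∘ₗ W.subtype
  let K : Submodule ℝ W := LinearMap.ker P
  have hKdim : n - m ≤ Module.finrank ℝ K := by
    have h1 := LinearMap.finrank_range_add_finrank_ker P
    have h2 := Submodule.finrank_le (LinearMap.range P)
    rw [hW, Fintype.card_fin] at h1
    change _ + Module.finrank ℝ K = n at h1
    omega
  have hKY : K.map W.subtype ≤ Yᗮ := by
    rintro _ ⟨x, hx, rfl⟩
    exact (Y.orthogonalProjectionOnto_eq_zero_iff).1 hx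
  have hproj : ∀ i, ‖K.starProjection (g i)‖ ≤ s := by
    intro i
    refine le_trans ?_ (hY i)
    have hinner : inner ℝ (K.starProjection (g i)) (g i) = ‖K.starProjection (g i)‖ ^ 2 := by
      rw [← real_inner_self_eq_norm_sq, K.inner_starProjection_left_eq_right,
        K.inner_starProjection_left_eq_right,
        starProjection_eq_self_iff.2 (K.starProjection_apply_mem (g i))]
    exact norm_le_infDist_of_mem_orthogonal
      (hKY ⟨_, K.starProjection_apply_mem _, rfl⟩) hinner
  have hdist : ∀ i, infDist (f i) (span ℝ (f '' Set.Iio i) : Submodule ℝ H) ≤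
      |inner ℝ (b i) (g i)| := by
    intro i
    refine le_trans (le_of_eq ?_)
      ((infDist_span_Iio_le_norm_gramSchmidt g i).trans (norm_gramSchmidt_le_abs_inner hW g i))
    rw [← infDist_image W.subtypeₗᵢ.isometry]
    have : f '' Set.Iio i = W.subtype '' (g '' Set.Iio i) := by
      rw [← Set.image_comp]; rfl
    rw [this, span_image]
    rfl
  calc _ ≤ ∏ i, |inner ℝ (b i) (g i)| :=
        Finset.prod_le_prod (fun _ _ => infDist_nonneg) fun i _ => hdist i
    _ = |b.toBasis.det g| := by
        rw [← Finset.abs_prod]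
        exact congrArg _ (gramSchmidtOrthonormalBasis_det hW g).symm
    _ ≤ √2 ^ n * s ^ Module.finrank ℝ K :=
        b.abs_det_le_of_norm_starProjection_le K hs hf hproj
    _ ≤ √2 ^ n * s ^ (n - m) := by
        gcongr ?_ * ?_
        exact pow_le_pow_of_le_one hs.le hs1 hKdim

theorem one_mem_upperBounds_infDist_image {H : Type*} [NormedAddCommGroup H] [InnerProductSpace ℝ H]
    {F : Set H} (hFb : ∀ g ∈ F, ‖g‖ ≤ 1) (Y : Submodule ℝ H) :
    1 ∈ upperBounds ((fun g => infDist g (Y : Set H)) '' F) := by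
  rintro _ ⟨g, hg, rfl⟩
  have := infDist_le_dist_of_mem (x := g) (SetLike.mem_coe.2 Y.zero_mem)
  rw [dist_zero_right] at this
  exact this.trans (hFb g hg)

/-- Corollary 3.2 (i): `σ_n ≤ √2 γ⁻¹ d_m^{(n-m)/n}` for every `1 ≤ m < n`. -/
theorem weak_greedy_hilbert_rate
    {H : Type*} [NormedAddCommGroup H] [InnerProductSpace ℝ H] [CompleteSpace H]
    (γ : ℝ) (hγ0 : 0 < γ) (hγ1 : γ ≤ 1)
    (F : Set H) (hFc : IsCompact F) (hFb : ∀ g ∈ F, ‖g‖ ≤ 1)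
    (f : ℕ → H) (hfF : ∀ n, f n ∈ F)
    (σ : ℕ → ℝ)
    (hσ : ∀ n, σ n =
      sSup ((fun g => infDist g ((span ℝ (f '' Set.Iio n) : Submodule ℝ H) : Set H)) '' F))
    (hgreedy : ∀ n, γ * σ n ≤
      infDist (f n) ((span ℝ (f '' Set.Iio n) : Submodule ℝ H) : Set H))
    (d : ℕ → ℝ)
    (hd : ∀ m, d m =
      ⨅ Y : {Y : Submodule ℝ H // FiniteDimensional ℝ Y ∧ Module.finrank ℝ Y ≤ m},
        sSup ((fun g => infDist g ((Y : Submodule ℝ H) : Set H)) '' F))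
    (n m : ℕ) (hn : 2 ≤ n) (hm : 1 ≤ m) (hmn : m < n) :
    σ n ≤ Real.sqrt 2 * γ⁻¹ * d m ^ (((n : ℝ) - m) / n) := by
  have hFne : F.Nonempty := ⟨f 0, hfF 0⟩
  have hbdd : ∀ Y : Submodule ℝ H, BddAbove ((fun g => infDist g (Y : Set H)) '' F) :=
    fun Y => ⟨1, one_mem_upperBounds_infDist_image hFb Y⟩
  have hσ0 : ∀ k, 0 ≤ σ k := fun k => by
    rw [hσ]
    exact Real.sSup_nonneg (by rintro _ ⟨g, -, rfl⟩; exact infDist_nonneg)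
  have hσ1 : ∀ k, σ k ≤ 1 := fun k => by
    rw [hσ]
    exact csSup_le (hFne.image _) (one_mem_upperBounds_infDist_image hFb _)
  have hσanti : ∀ i ≤ n, σ n ≤ σ i := fun i hi => by
    rw [hσ, hσ]
    refine csSup_le (hFne.image _) ?_
    rintro _ ⟨g, hg, rfl⟩
    refine le_trans ?_ (le_csSup (hbdd _) ⟨g, hg, rfl⟩)
    exact infDist_le_infDist_of_subset
      (span_mono (Set.image_mono (Set.Iio_subset_Iio hi))) ⟨0, zero_mem _⟩
  have hd0 : 0 ≤ d m := by
    rw [hd]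
    refine Real.iInf_nonneg fun Y => Real.sSup_nonneg ?_
    rintro _ ⟨g, -, rfl⟩
    exact infDist_nonneg
  have hn0 : (0 : ℝ) < n := by positivity
  have hexp : 0 ≤ ((n : ℝ) - m) / n :=
    div_nonneg (sub_nonneg.2 (by exact_mod_cast hmn.le)) hn0.le
  suffices hmain : γ * σ n ≤ √2 * d m ^ (((n : ℝ) - m) / n) by
    rw [mul_right_comm, ← div_eq_mul_inv, le_div_iff₀ hγ0, mul_comm]
    exact hmain
  rcases le_or_gt 1 (d m) with hd1 | hd1
  · calc γ * σ n ≤ 1 * 1 := mul_le_mul hγ1 (hσ1 n) (hσ0 n) zero_le_one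
      _ ≤ √2 * d m ^ (((n : ℝ) - m) / n) :=
        mul_le_mul (Real.one_le_sqrt.2 one_le_two) (Real.one_le_rpow hd1 hexp) zero_le_one
          (Real.sqrt_nonneg 2)
  have hbound : ∀ s ∈ Set.Ioo (d m) 1, γ * σ n ≤ √2 * s ^ (((n : ℝ) - m) / n) := by
    rintro s ⟨hds, hs1⟩
    have hs : 0 < s := hd0.trans_lt hds
    have : Nonempty {Y : Submodule ℝ H // FiniteDimensional ℝ Y ∧ Module.finrank ℝ Y ≤ m} :=
      ⟨⟨⊥, inferInstance, by simp⟩⟩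
    rw [hd] at hds
    obtain ⟨⟨Y, hYfin, hYm⟩, hYs⟩ := exists_lt_of_ciInf_lt hds
    have hprod := prod_infDist_span_Iio_le (f := fun i : Fin n => f i) hs hs1.le
      (fun i => hFb _ (hfF i)) Y hYm
      fun i => (le_csSup (hbdd Y) ⟨f i, hfF i, rfl⟩).trans hYs.le
    have hpow : (γ * σ n) ^ n ≤ √2 ^ n * s ^ (n - m) := by
      refine le_trans ?_ hprod
      rw [← Fin.prod_const]
      refine Finset.prod_le_prod (fun _ _ => mul_nonneg hγ0.le (hσ0 n)) fun i _ => ?_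
      refine (mul_le_mul_of_nonneg_left (hσanti i i.2.le) hγ0.le).trans ((hgreedy i).trans ?_)
      refine infDist_le_infDist_of_subset (span_mono ?_) ⟨0, zero_mem _⟩
      rintro _ ⟨j, hj, rfl⟩
      exact ⟨j, hj, rfl⟩
    refine le_of_pow_le_pow_left₀ (n := n) (by omega) (by positivity) (hpow.trans_eq ?_)
    rw [mul_pow, ← Real.rpow_mul_natCast hs.le, div_mul_cancel₀ _ hn0.ne', ← Nat.cast_sub hmn.le,
      Real.rpow_natCast]
  have hlim : Filter.Tendsto (fun s : ℝ => √2 * s ^ (((n : ℝ) - m) / n))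
      (nhdsWithin (d m) (Set.Ioi (d m)))
      (nhds (√2 * d m ^ (((n : ℝ) - m) / n))) :=
    ((Real.continuousAt_rpow_const _ _ (Or.inr hexp)).tendsto.mono_left
      nhdsWithin_le_nhds).const_mul _
  refine ge_of_tendsto hlim ?_
  filter_upwards [Ioo_mem_nhdsGT hd1] with s hs using hbound s hs
end

section
/- For every n ≥ 1, one has σ_{2n} ≤ √2 · γ^{−1} · √(d_n). -/
open Metric Submodule
open scoped RealInnerProductSpace

section GramMatrix

open Matrix InnerProductSpace

variable {E ι : Type*} [NormedAddCommGroup E] [InnerProductSpace ℝ E] [Fintype ι] [DecidableEq ι]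

omit [DecidableEq ι] in
theorem gram_sum_smul (B : Matrix ι ι ℝ) (v : ι → E) :
    gram ℝ (fun j => ∑ i, B j i • v i) = B * gram ℝ v * Bᵀ := by
  ext j k
  simp only [gram_apply, mul_apply, transpose_apply, sum_inner, inner_sum, real_inner_smul_left,
    real_inner_smul_right, Finset.sum_mul]
  exact Finset.sum_congr rfl fun _ _ => Finset.sum_congr rfl fun _ _ => by ring

theorem det_gram_sum_smul {B : Matrix ι ι ℝ} (hB : B * Bᵀ = 1) (v : ι → E) :
    (gram ℝ fun j => ∑ i, B j i • v i).det = (gram ℝ v).det := by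
  rw [gram_sum_smul, det_mul_right_comm, hB, one_mul]

theorem sum_norm_sq_sum_smul {B : Matrix ι ι ℝ} (hB : B * Bᵀ = 1) (v : ι → E) :
    ∑ j, ‖∑ i, B j i • v i‖ ^ 2 = ∑ i, ‖v i‖ ^ 2 := by
  have key := congrArg trace (gram_sum_smul B v)
  rw [trace_mul_comm, ← mul_assoc, mul_eq_one_comm.mp hB, one_mul] at key
  simpa only [trace, diag_apply, gram_apply, real_inner_self_eq_norm_sq] using key

variable [LinearOrder ι] [LocallyFiniteOrderBot ι] [WellFoundedLT ι]

theorem det_gram_eq_prod_norm_gramSchmidt (v : ι → E) :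
    (gram ℝ v).det = ∏ i, ‖gramSchmidt ℝ v i‖ ^ 2 := by
  set g := gramSchmidt ℝ v with hg
  let L : Matrix ι ι ℝ := of fun i j =>
    if j = i then 1 else if j < i then ⟪g j, v i⟫ / ‖g j‖ ^ 2 else 0
  have hL : L.IsLowerTriangular := by
    intro i j hij
    have hij : i < j := hij
    simp [L, hij.ne', hij.not_gt]
  have hdet : L.det = 1 := by
    rw [det_of_isLowerTriangular L hL]
    simp [L]
  have hv : v = fun i => ∑ j, L i j • g j := by
    funext i
    conv_lhs => rw [gramSchmidt_def'' ℝ v i]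
    rw [← Finset.add_sum_erase _ _ (Finset.mem_univ i)]
    congr 1
    · simp [L, hg]
    · refine Finset.sum_subset_zero_on_sdiff (fun j hj => ?_) (fun j hj => ?_) (fun j hj => ?_)
      · simpa using (Finset.mem_Iio.mp hj).ne
      · have h1 : j ≠ i := by simp at hj; tauto
        have h2 : ¬ j < i := by simp at hj; exact hj.2.not_gt
        simp [L, h1, h2]
      · have h := Finset.mem_Iio.mp hj
        simp [L, h, h.ne, hg]
  have hgram : gram ℝ g = diagonal fun i => ‖g i‖ ^ 2 := by
    ext i j
    by_cases hij : i = j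
    · subst hij
      simp
    · simp [hij, hg, gramSchmidt_orthogonal ℝ v hij]
  conv_lhs => rw [hv]
  rw [gram_sum_smul, det_mul, det_mul, det_transpose, hdet, hgram, det_diagonal]
  simp

omit [Fintype ι] [DecidableEq ι] in
theorem sub_gramSchmidt_mem_span (v : ι → E) (i : ι) :
    v i - gramSchmidt ℝ v i ∈ span ℝ (v '' Set.Iio i) := by
  rw [← span_gramSchmidt_Iio ℝ v i, sub_eq_iff_eq_add'.mpr (gramSchmidt_def'' ℝ v i)]
  exact sum_mem fun k hk => smul_mem _ _ <| subset_span <|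
    Set.mem_image_of_mem _ (Finset.mem_Iio.mp hk)

omit [Fintype ι] [DecidableEq ι] in
theorem infDist_span_Iio_le_norm_gramSchmidt_s3 (v : ι → E) (i : ι) :
    infDist (v i) (span ℝ (v '' Set.Iio i) : Set E) ≤ ‖gramSchmidt ℝ v i‖ := by
  simpa [dist_eq_norm] using infDist_le_dist_of_mem (x := v i) (sub_gramSchmidt_mem_span v i)

omit [Fintype ι] [DecidableEq ι] in
theorem norm_gramSchmidt_le (v : ι → E) (i : ι) : ‖gramSchmidt ℝ v i‖ ≤ ‖v i‖ := by
  have h : ⟪gramSchmidt ℝ v i, v i - gramSchmidt ℝ v i⟫ = 0 := by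
    rw [sub_eq_iff_eq_add'.mpr (gramSchmidt_def'' ℝ v i), inner_sum]
    refine Finset.sum_eq_zero fun k hk => ?_
    rw [real_inner_smul_right, gramSchmidt_orthogonal ℝ v (Finset.mem_Iio.mp hk).ne', mul_zero]
  have h2 := norm_add_sq_eq_norm_sq_add_norm_sq_of_inner_eq_zero _ _ h
  rw [add_sub_cancel] at h2
  nlinarith [norm_nonneg (v i), norm_nonneg (gramSchmidt ℝ v i),
    norm_nonneg (v i - gramSchmidt ℝ v i)]

/-- Hadamard's inequality for Gram determinants. -/
theorem det_gram_le_prod_norm_sq (v : ι → E) : (gram ℝ v).det ≤ ∏ i, ‖v i‖ ^ 2 := by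
  rw [det_gram_eq_prod_norm_gramSchmidt]
  exact Finset.prod_le_prod (fun _ _ => by positivity) fun i _ =>
    pow_le_pow_left₀ (norm_nonneg _) (norm_gramSchmidt_le v i) 2

theorem prod_infDist_sq_le_det_gram (v : ι → E) :
    ∏ i, infDist (v i) (span ℝ (v '' Set.Iio i) : Set E) ^ 2 ≤ (gram ℝ v).det := by
  rw [det_gram_eq_prod_norm_gramSchmidt]
  exact Finset.prod_le_prod (fun _ _ => by positivity) fun i _ =>
    pow_le_pow_left₀ infDist_nonneg (infDist_span_Iio_le_norm_gramSchmidt_s3 v i) 2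

end GramMatrix

/-- The arithmetic-geometric mean inequality, with natural powers. -/
theorem prod_le_pow_of_sum_le {ι : Type*} {s : Finset ι} {n : ℕ} (hn : s.card = n) {z : ι → ℝ}
    (hz : ∀ i ∈ s, 0 ≤ z i) {c : ℝ} (hc : ∑ i ∈ s, z i ≤ n * c) : ∏ i ∈ s, z i ≤ c ^ n := by
  subst hn
  rcases s.eq_empty_or_nonempty with rfl | hs
  · simp
  have hpos : (0 : ℝ) < s.card := by exact_mod_cast hs.card_pos
  have h := Real.geom_mean_le_arith_mean s (fun _ => 1) z (by simp) (by simpa using hs) hz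
  simp only [Real.rpow_one, Finset.sum_const, nsmul_eq_mul, mul_one, one_mul] at h
  have hP : 0 ≤ ∏ i ∈ s, z i := Finset.prod_nonneg hz
  calc ∏ i ∈ s, z i = ((∏ i ∈ s, z i) ^ ((s.card : ℝ)⁻¹)) ^ s.card :=
        (Real.rpow_inv_natCast_pow hP hs.card_pos.ne').symm
    _ ≤ c ^ s.card := pow_le_pow_left₀ (by positivity)
        (h.trans ((div_le_iff₀' hpos).mpr hc)) _

/-- If a family indexed by `Fin (n + m)` lies in a subspace of dimension at most `n`, then some
orthogonal matrix has `m` rows that annihilate it. -/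
theorem exists_orthogonal_matrix_annihilating {E : Type*} [NormedAddCommGroup E]
    [InnerProductSpace ℝ E] {n m : ℕ} (Y : Submodule ℝ E) [FiniteDimensional ℝ Y]
    (hY : Module.finrank ℝ Y ≤ n) (p : Fin (n + m) → Y) :
    ∃ (B : Matrix (Fin (n + m)) (Fin (n + m)) ℝ) (s : Finset (Fin (n + m))),
      B * B.transpose = 1 ∧ s.card = m ∧ ∀ j ∈ s, ∑ i, B j i • p i = 0 := by
  let T : EuclideanSpace ℝ (Fin (n + m)) →ₗ[ℝ] Y :=
    (Fintype.linearCombination ℝ p).comp (WithLp.linearEquiv 2 ℝ (Fin (n + m) → ℝ)).toLinearMap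
  have hT : ∀ x, T x = ∑ i, x i • p i := fun x => by
    simp [T, Fintype.linearCombination_apply]
  have hN : m ≤ Module.finrank ℝ (LinearMap.ker T) := by
    have h1 := T.finrank_range_add_finrank_ker
    have h2 := Submodule.finrank_le (LinearMap.range T)
    simp only [finrank_euclideanSpace, Fintype.card_fin] at h1
    omega
  let e := stdOrthonormalBasis ℝ (LinearMap.ker T)
  let v : Fin (n + m) → EuclideanSpace ℝ (Fin (n + m)) := fun i =>
    if h : (i : ℕ) < m then (e ⟨i, h.trans_le hN⟩ : EuclideanSpace ℝ (Fin (n + m))) else 0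
  have hv : Orthonormal ℝ (Set.domRestrict {i : Fin (n + m) | (i : ℕ) < m} v) := by
    have h : Set.domRestrict {i : Fin (n + m) | (i : ℕ) < m} v =
        fun i => (e ⟨i.1, i.2.trans_le hN⟩ : EuclideanSpace ℝ (Fin (n + m))) := by
      funext i
      have := i.2
      simp only [Set.mem_ofPred_eq] at this
      simp [v, this]
    rw [h]
    refine ((e.orthonormal.comp_linearIsometry (LinearMap.ker T).subtypeₗᵢ).comp
      (fun i : {i : Fin (n + m) | (i : ℕ) < m} => ⟨i.1, i.2.trans_le hN⟩) ?_)
    intro i j hij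
    simpa [Subtype.ext_iff, Fin.ext_iff] using hij
  obtain ⟨b, hb⟩ := hv.exists_orthonormalBasis_extension_of_card_eq (by simp)
  refine ⟨Matrix.of fun j i => b j i, Finset.univ.filter fun i => (i : ℕ) < m, ?_, ?_, ?_⟩
  · ext j k
    have h := orthonormal_iff_ite.mp b.orthonormal k j
    simp only [PiLp.inner_apply, RCLike.inner_apply, conj_trivial] at h
    simp only [Matrix.mul_apply, Matrix.of_apply, Matrix.transpose_apply, Matrix.one_apply, h,
      eq_comm]
  · rw [Fin.card_filter_val_lt]
    simp
  · intro j hj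
    have hj : (j : ℕ) < m := by simpa using hj
    simp only [Matrix.of_apply]
    rw [← hT, hb j hj]
    simp only [v, hj, dif_pos]
    exact (e _).2

theorem infDist_eq_norm_sub_starProjection {E : Type*} [NormedAddCommGroup E]
    [InnerProductSpace ℝ E] (Y : Submodule ℝ E) [Y.HasOrthogonalProjection] (x : E) :
    infDist x (Y : Set E) = ‖x - Y.starProjection x‖ := by
  rw [infDist_eq_iInf, starProjection_minimal]
  simp only [dist_eq_norm]
  rfl

theorem det_gram_le_of_infDist_le {E : Type*} [NormedAddCommGroup E] [InnerProductSpace ℝ E]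
    {n : ℕ} (Y : Submodule ℝ E) [FiniteDimensional ℝ Y] (hY : Module.finrank ℝ Y ≤ n)
    (v : Fin (n + n) → E) (hv : ∀ i, ‖v i‖ ≤ 1) {D : ℝ}
    (hD : ∀ i, infDist (v i) (Y : Set E) ≤ D) :
    (Matrix.gram ℝ v).det ≤ (2 * D) ^ (2 * n) := by
  obtain ⟨B, s, hB, hs, hBs⟩ :=
    exists_orthogonal_matrix_annihilating Y hY fun i => Y.orthogonalProjectionOnto (v i)
  set u : Fin (n + n) → E := fun j => ∑ i, B j i • v i with hu
  have hsc : sᶜ.card = n := by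
    rw [Finset.card_compl, hs]
    simp
  have h1 : ∏ j ∈ s, ‖u j‖ ^ 2 ≤ (2 * D ^ 2) ^ n := by
    refine prod_le_pow_of_sum_le hs (fun _ _ => by positivity) ?_
    have hus : ∀ j ∈ s, u j = ∑ i, B j i • (v i - Y.starProjection (v i)) := by
      intro j hj
      have h := congrArg (Subtype.val : Y → E) (hBs j hj)
      simp only [Submodule.coe_sum, Submodule.coe_smul, ZeroMemClass.coe_zero] at h
      simp only [smul_sub, Finset.sum_sub_distrib, starProjection_apply, h, sub_zero, hu]
    calc ∑ j ∈ s, ‖u j‖ ^ 2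
        = ∑ j ∈ s, ‖∑ i, B j i • (v i - Y.starProjection (v i))‖ ^ 2 :=
          Finset.sum_congr rfl fun j hj => by rw [hus j hj]
      _ ≤ ∑ j, ‖∑ i, B j i • (v i - Y.starProjection (v i))‖ ^ 2 :=
          Finset.sum_le_sum_of_subset_of_nonneg (Finset.subset_univ _) fun _ _ _ => by positivity
      _ = ∑ i, ‖v i - Y.starProjection (v i)‖ ^ 2 := sum_norm_sq_sum_smul hB _
      _ ≤ ∑ _i : Fin (n + n), D ^ 2 := Finset.sum_le_sum fun i _ =>
          pow_le_pow_left₀ (norm_nonneg _)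
            ((infDist_eq_norm_sub_starProjection Y (v i)).symm.le.trans (hD i)) 2
      _ = n * (2 * D ^ 2) := by
          simp
          ring
  have h2 : ∏ j ∈ sᶜ, ‖u j‖ ^ 2 ≤ 2 ^ n := by
    refine prod_le_pow_of_sum_le hsc (fun _ _ => by positivity) ?_
    calc ∑ j ∈ sᶜ, ‖u j‖ ^ 2
        ≤ ∑ j, ‖u j‖ ^ 2 :=
          Finset.sum_le_sum_of_subset_of_nonneg (Finset.subset_univ _) fun _ _ _ => by positivity
      _ = ∑ i, ‖v i‖ ^ 2 := sum_norm_sq_sum_smul hB _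
      _ ≤ ∑ _i : Fin (n + n), 1 := Finset.sum_le_sum fun i _ =>
          pow_le_one₀ (norm_nonneg _) (hv i)
      _ = n * 2 := by
          simp
          ring
  calc (Matrix.gram ℝ v).det = (Matrix.gram ℝ u).det := (det_gram_sum_smul hB v).symm
    _ ≤ ∏ j, ‖u j‖ ^ 2 := det_gram_le_prod_norm_sq u
    _ = (∏ j ∈ s, ‖u j‖ ^ 2) * ∏ j ∈ sᶜ, ‖u j‖ ^ 2 := (Finset.prod_mul_prod_compl s _).symm
    _ ≤ (2 * D ^ 2) ^ n * 2 ^ n := mul_le_mul h1 h2 (by positivity) (by positivity)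
    _ = (2 * D) ^ (2 * n) := by
        rw [← mul_pow, pow_mul]
        ring

theorem bddAbove_infDist_image {E : Type*} [NormedAddCommGroup E] [InnerProductSpace ℝ E]
    {F : Set E} (hF : ∀ g ∈ F, ‖g‖ ≤ 1) (Y : Submodule ℝ E) :
    BddAbove ((fun g => infDist g (Y : Set E)) '' F) := by
  refine ⟨1, ?_⟩
  rintro _ ⟨g, hg, rfl⟩
  refine (infDist_le_dist_of_mem Y.zero_mem).trans ?_
  simpa using hF g hg

/-- Corollary 3.2 (i), particular case: `σ_{2n} ≤ √2 γ⁻¹ √(d_n)`. -/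
theorem weak_greedy_hilbert_sqrt
    {H : Type*} [NormedAddCommGroup H] [InnerProductSpace ℝ H] [CompleteSpace H]
    (γ : ℝ) (hγ0 : 0 < γ) (hγ1 : γ ≤ 1)
    (F : Set H) (hFc : IsCompact F) (hFb : ∀ g ∈ F, ‖g‖ ≤ 1)
    (f : ℕ → H) (hfF : ∀ n, f n ∈ F)
    (σ : ℕ → ℝ)
    (hσ : ∀ n, σ n =
      sSup ((fun g => infDist g ((span ℝ (f '' Set.Iio n) : Submodule ℝ H) : Set H)) '' F))
    (hgreedy : ∀ n, γ * σ n ≤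
      infDist (f n) ((span ℝ (f '' Set.Iio n) : Submodule ℝ H) : Set H))
    (d : ℕ → ℝ)
    (hd : ∀ m, d m =
      ⨅ Y : {Y : Submodule ℝ H // FiniteDimensional ℝ Y ∧ Module.finrank ℝ Y ≤ m},
        sSup ((fun g => infDist g ((Y : Submodule ℝ H) : Set H)) '' F))
    (n : ℕ) (hn : 1 ≤ n) :
    σ (2 * n) ≤ Real.sqrt 2 * γ⁻¹ * Real.sqrt (d n) := by
  have hσ0 : ∀ k, 0 ≤ σ k := fun k => by
    rw [hσ]
    refine Real.sSup_nonneg ?_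
    rintro _ ⟨g, -, rfl⟩
    exact infDist_nonneg
  have hanti : ∀ {k l}, k ≤ l → σ l ≤ σ k := fun {k l} hkl => by
    rw [hσ, hσ]
    refine csSup_le (Set.Nonempty.image _ ⟨f 0, hfF 0⟩) ?_
    rintro _ ⟨g, hg, rfl⟩
    refine le_trans ?_ (le_csSup (bddAbove_infDist_image hFb _) (Set.mem_image_of_mem _ hg))
    exact infDist_le_infDist_of_subset
      (span_mono (Set.image_mono (Set.Iio_subset_Iio hkl))) ⟨0, zero_mem _⟩
  have hγσ : 0 ≤ γ * σ (2 * n) := mul_nonneg hγ0.le (hσ0 _)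
  have hwidth : (γ * σ (2 * n)) ^ 2 / 2 ≤ d n := by
    rw [hd]
    have : Nonempty {Y : Submodule ℝ H // FiniteDimensional ℝ Y ∧ Module.finrank ℝ Y ≤ n} :=
      ⟨⟨⊥, inferInstance, by simp⟩⟩
    refine le_ciInf ?_
    rintro ⟨Y, hYfin, hY⟩
    set D := sSup ((fun g => infDist g (Y : Set H)) '' F)
    have hD : ∀ g ∈ F, infDist g (Y : Set H) ≤ D := fun g hg =>
      le_csSup (bddAbove_infDist_image hFb _) (Set.mem_image_of_mem _ hg)
    have hD0 : 0 ≤ D := infDist_nonneg.trans (hD _ (hfF 0))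
    let v : Fin (n + n) → H := fun i => f i
    have hspan : ∀ i : Fin (n + n), v '' Set.Iio i = f '' Set.Iio (i : ℕ) := by
      intro i
      ext x
      constructor
      · rintro ⟨j, hj, rfl⟩
        exact ⟨j, hj, rfl⟩
      · rintro ⟨j, hj, rfl⟩
        exact ⟨⟨j, lt_trans hj i.2⟩, hj, rfl⟩
    have hle : ((γ * σ (2 * n)) ^ 2) ^ (2 * n) ≤ (2 * D) ^ (2 * n) := by
      calc ((γ * σ (2 * n)) ^ 2) ^ (2 * n) = ∏ _i : Fin (n + n), (γ * σ (2 * n)) ^ 2 := by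
            simp [two_mul]
        _ ≤ ∏ i, infDist (v i) (span ℝ (v '' Set.Iio i) : Set H) ^ 2 := by
            refine Finset.prod_le_prod (fun _ _ => by positivity) fun i _ =>
              pow_le_pow_left₀ hγσ ?_ 2
            rw [hspan]
            exact (mul_le_mul_of_nonneg_left (hanti (by omega)) hγ0.le).trans (hgreedy i)
        _ ≤ (Matrix.gram ℝ v).det := prod_infDist_sq_le_det_gram v
        _ ≤ (2 * D) ^ (2 * n) :=
            det_gram_le_of_infDist_le Y hY v (fun i => hFb _ (hfF i)) fun i => hD _ (hfF i)
    have := (pow_le_pow_iff_left₀ (by positivity) (by positivity) (by omega)).mp hle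
    linarith
  have hsqrt : γ * σ (2 * n) ≤ Real.sqrt 2 * Real.sqrt (d n) := by
    rw [← Real.sqrt_mul zero_le_two]
    exact Real.le_sqrt_of_sq_le (by linarith)
  calc σ (2 * n) = γ⁻¹ * (γ * σ (2 * n)) := by field_simp
    _ ≤ γ⁻¹ * (Real.sqrt 2 * Real.sqrt (d n)) := by gcongr
    _ = Real.sqrt 2 * γ⁻¹ * Real.sqrt (d n) := by ring
end

section
/- Let α > 0, C_0 > 0 and c_0 > 0. If d_n ≤ C_0 · e^{−c_0 n^{α}} for all n ≥ 1, then σ_n ≤ √(2 C_0) · γ^{−1} · e^{−c_1 n^{α}} for all n ≥ 2, where c_1 := 2^{−1−2α} · c_0. -/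
open Metric Submodule

open Matrix in
/-- The AM-GM inequality for the eigenvalues of a positive semidefinite matrix. -/
lemma Matrix.PosSemidef.det_le_pow {n : ℕ} {S : Matrix (Fin n) (Fin n) ℝ} (hS : S.PosSemidef)
    {b : ℝ} (hb : S.trace ≤ n * b) : S.det ≤ b ^ n := by
  rcases Nat.eq_zero_or_pos n with rfl | hn
  · simp
  have hn' : (0 : ℝ) < n := by exact_mod_cast hn
  rw [hS.1.trace_eq_sum_eigenvalues] at hb
  rw [hS.1.det_eq_prod_eigenvalues]
  have h0 : ∀ i, 0 ≤ hS.1.eigenvalues i := fun i => hS.eigenvalues_nonneg i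
  have key := Real.geom_mean_le_arith_mean Finset.univ (fun _ : Fin n => (1 : ℝ))
    hS.1.eigenvalues (fun _ _ => zero_le_one) (by simpa using hn) (fun i _ => h0 i)
  simp only [Real.rpow_one, one_mul, Finset.sum_const, Finset.card_univ, Fintype.card_fin,
    nsmul_eq_mul, mul_one] at key
  have hp : 0 ≤ ∏ i, hS.1.eigenvalues i := Finset.prod_nonneg fun i _ => h0 i
  have hle : (∏ i, hS.1.eigenvalues i) ^ ((n : ℝ)⁻¹) ≤ b :=
    key.trans (by rw [div_le_iff₀ hn']; simpa [mul_comm] using hb)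
  have := pow_le_pow_left₀ (Real.rpow_nonneg hp _) hle n
  rwa [Real.rpow_inv_natCast_pow hp hn.ne'] at this

open Matrix in
lemma Matrix.IsHermitian.pow_le_det {n : Type*} [Fintype n] [DecidableEq n] {S : Matrix n n ℝ}
    (hS : S.IsHermitian) {a : ℝ} (ha : 0 ≤ a) (h : (S - a • (1 : Matrix n n ℝ)).PosSemidef) :
    a ^ Fintype.card n ≤ S.det := by
  have he : ∀ i, a ≤ hS.eigenvalues i := by
    intro i
    have h1 := h.dotProduct_mulVec_nonneg (hS.eigenvectorBasis i).ofLp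
    have h2 := hS.eigenvalues_eq i
    have h3 : star (hS.eigenvectorBasis i).ofLp ⬝ᵥ (hS.eigenvectorBasis i).ofLp = 1 := by
      have := hS.eigenvectorBasis.orthonormal.1 i
      rw [EuclideanSpace.norm_eq, Real.sqrt_eq_one] at this
      simpa [dotProduct, sq] using this
    simp only [sub_mulVec, smul_mulVec, one_mulVec, dotProduct_sub, dotProduct_smul, h3] at h1
    simp only [RCLike.re_to_real] at h2
    rw [h2]
    simpa using h1
  rw [hS.det_eq_prod_eigenvalues]
  calc a ^ Fintype.card n = ∏ _i : n, a := by simp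
    _ ≤ _ := Finset.prod_le_prod (fun _ _ => ha) (fun i _ => he i)

open Matrix in
/-- Bessel's inequality in matrix form. -/
lemma Orthonormal.posSemidef_one_sub_transpose_mul {H ι κ : Type*} [NormedAddCommGroup H]
    [InnerProductSpace ℝ H] [Fintype ι] [Fintype κ] [DecidableEq κ] {u : ι → H} {v : κ → H}
    (hu : Orthonormal ℝ u) (hv : Orthonormal ℝ v) :
    (1 - (Matrix.of fun i j => inner ℝ (u i) (v j))ᵀ *
      (Matrix.of fun i j => inner ℝ (u i) (v j)) : Matrix κ κ ℝ).PosSemidef := by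
  set B : Matrix ι κ ℝ := Matrix.of fun i j => inner ℝ (u i) (v j) with hB
  refine PosSemidef.of_dotProduct_mulVec_nonneg ?_ fun x => ?_
  · simp [IsHermitian, conjTranspose_eq_transpose_of_trivial]
  · have h1 : ∀ i, (B *ᵥ x) i = inner ℝ (u i) (∑ j, x j • v j) := by
      intro i
      simp [hB, mulVec, dotProduct, inner_sum, inner_smul_right, mul_comm]
    have h2 := hu.sum_inner_products_le (∑ j, x j • v j) (s := Finset.univ)
    have h3 : ‖∑ j, x j • v j‖ ^ 2 = x ⬝ᵥ x := by
      rw [← real_inner_self_eq_norm_sq, hv.inner_sum]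
      simp [dotProduct]
    have h4 : x ⬝ᵥ ((Bᵀ * B) *ᵥ x) = (B *ᵥ x) ⬝ᵥ (B *ᵥ x) := by
      rw [← mulVec_mulVec, dotProduct_mulVec, vecMul_transpose]
    simp only [star_trivial, sub_mulVec, one_mulVec, dotProduct_sub, h4, sub_nonneg]
    rw [← h3]
    simpa [dotProduct, h1, sq_abs, ← sq] using h2

/-- The squared distance to a finite-dimensional subspace in orthonormal coordinates. -/
lemma norm_sq_sub_sum_inner_sq_le {H ι : Type*} [NormedAddCommGroup H] [InnerProductSpace ℝ H]
    [Fintype ι] {Y : Submodule ℝ H} [FiniteDimensional ℝ Y] (y : OrthonormalBasis ι ℝ Y) {g : H}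
    {δ : ℝ} (hg : infDist g (Y : Set H) ≤ δ) :
    ‖g‖ ^ 2 - ∑ a, inner ℝ (y a : H) g ^ 2 ≤ δ ^ 2 := by
  have h1 : ∑ a, inner ℝ (y a : H) g ^ 2 = ‖Y.orthogonalProjectionOnto g‖ ^ 2 := by
    rw [← y.sum_sq_norm_inner_right]
    refine Finset.sum_congr rfl fun a _ => ?_
    rw [Submodule.coe_inner, ← Submodule.starProjection_apply,
      ← Submodule.inner_starProjection_left_eq_right, Submodule.starProjection_eq_self_iff.2 (y a).2]
    simp
  have h2 : ‖g - Y.starProjection g‖ ≤ δ := by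
    rw [Submodule.starProjection_minimal]
    refine le_trans (le_of_eq ?_) hg
    rw [infDist_eq_iInf]
    simp [dist_eq_norm]
  have h3 := Submodule.norm_sq_eq_add_norm_sq_starProjection g Y
  rw [Submodule.starProjection_orthogonal_val] at h3
  have h4 := pow_le_pow_left₀ (norm_nonneg _) h2 2
  rw [h1, h3]
  simp only [Submodule.starProjection_apply, Submodule.coe_norm] at *
  linarith

open Matrix in
/-- The volume spanned by vectors of the unit ball close to a subspace of small dimension. -/
lemma Orthonormal.pow_finrank_mul_det_sq_le {H : Type*} [NormedAddCommGroup H]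
    [InnerProductSpace ℝ H] {n : ℕ} {q v : Fin n → H} (hq : Orthonormal ℝ q)
    (hv : ∀ j, v j ∈ span ℝ (Set.range q)) (hv1 : ∀ j, ‖v j‖ ≤ 1) (Y : Submodule ℝ H)
    [FiniteDimensional ℝ Y] {δ : ℝ} (hδ0 : 0 ≤ δ) (hδ1 : δ ≤ 1)
    (hd : ∀ j, infDist (v j) (Y : Set H) ≤ δ) :
    (δ ^ 2) ^ Module.finrank ℝ Y *
      (Matrix.of fun i j => inner ℝ (q i) (v j) : Matrix (Fin n) (Fin n) ℝ).det ^ 2 ≤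
      (2 * δ ^ 2) ^ n := by
  set y := stdOrthonormalBasis ℝ Y with hy_def
  set k := Module.finrank ℝ Y with hk
  have hy : Orthonormal ℝ (fun a => (y a : H)) :=
    y.orthonormal.comp_linearIsometry Y.subtypeₗᵢ
  set M : Matrix (Fin n) (Fin n) ℝ := Matrix.of fun i j => inner ℝ (q i) (v j) with hM
  set B : Matrix (Fin k) (Fin n) ℝ := Matrix.of fun i j => inner ℝ (y i : H) (q j) with hB
  set c := 1 - δ ^ 2 with hc
  have hδ2 : δ ^ 2 ≤ 1 := pow_le_one₀ hδ0 hδ1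
  have hc0 : 0 ≤ c := by linarith
  have hexp : ∀ j, ∑ i, M i j • q i = v j := by
    intro j
    obtain ⟨a, ha⟩ := (mem_span_range_iff_exists_fun ℝ).1 (hv j)
    rw [← ha]
    refine Finset.sum_congr rfl fun i _ => ?_
    rw [hM, Matrix.of_apply, ← ha, hq.inner_right_fintype]
  have hBM : ∀ a j, (B * M) a j = inner ℝ (y a : H) (v j) := by
    intro a j
    rw [← hexp j, inner_sum, Matrix.mul_apply]
    simp [hB, inner_smul_right, mul_comm]
  have hMM : ∀ j, (Mᵀ * M) j j = ‖v j‖ ^ 2 := by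
    intro j
    conv_rhs => rw [← real_inner_self_eq_norm_sq, ← hexp j, hq.inner_sum]
    simp [Matrix.mul_apply]
  have hB1 : (1 - Bᵀ * B).PosSemidef := hy.posSemidef_one_sub_transpose_mul hq
  have hB2 : (1 - B * Bᵀ).PosSemidef := by
    have := hq.posSemidef_one_sub_transpose_mul hy
    have e : (Matrix.of fun i j => inner ℝ (q i) (y j : H)) = Bᵀ := by
      ext i j; simp [hB, real_inner_comm]
    rwa [e, transpose_transpose] at this
  have hT : (1 - c • (Bᵀ * B)).PosSemidef := by
    have e : (1 - c • (Bᵀ * B)) = c • (1 - Bᵀ * B) + (δ ^ 2) • (1 : Matrix (Fin n) (Fin n) ℝ) := by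
      rw [hc]; module
    rw [e]
    exact (hB1.smul hc0).add (PosSemidef.one.smul (sq_nonneg δ))
  have hdet : (δ ^ 2) ^ k ≤ (1 - c • (Bᵀ * B)).det := by
    rw [← Matrix.smul_mul, Matrix.det_one_sub_mul_comm, Matrix.mul_smul]
    have e : (1 - c • (B * Bᵀ)) - (δ ^ 2) • (1 : Matrix (Fin k) (Fin k) ℝ) =
        c • (1 - B * Bᵀ) := by
      rw [hc]; module
    have hH : (1 - c • (B * Bᵀ)).IsHermitian := by
      simp [IsHermitian, conjTranspose_eq_transpose_of_trivial]
    simpa using hH.pow_le_det (sq_nonneg δ) (e ▸ hB2.smul hc0)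
  have hS : (Mᵀ * (1 - c • (Bᵀ * B)) * M).PosSemidef := by
    simpa [conjTranspose_eq_transpose_of_trivial] using hT.conjTranspose_mul_mul_same M
  have hSe : Mᵀ * (1 - c • (Bᵀ * B)) * M = Mᵀ * M - c • ((B * M)ᵀ * (B * M)) := by
    simp [Matrix.mul_sub, Matrix.sub_mul, Matrix.mul_assoc]
  have htr : (Mᵀ * (1 - c • (Bᵀ * B)) * M).trace ≤ n * (2 * δ ^ 2) := by
    rw [hSe, Matrix.trace]
    calc ∑ j, (Mᵀ * M - c • ((B * M)ᵀ * (B * M))).diag j ≤ ∑ _j : Fin n, 2 * δ ^ 2 := by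
          refine Finset.sum_le_sum fun j _ => ?_
          have e : ((B * M)ᵀ * (B * M)) j j = ∑ a, inner ℝ (y a : H) (v j) ^ 2 := by
            rw [Matrix.mul_apply]
            simp only [transpose_apply, hBM, sq]
          simp only [diag_apply, Matrix.sub_apply, Matrix.smul_apply, hMM, e, smul_eq_mul]
          have h1 := norm_sq_sub_sum_inner_sq_le y (hd j)
          have h2 : ‖v j‖ ^ 2 ≤ 1 := pow_le_one₀ (norm_nonneg _) (hv1 j)
          have h3 := hy.sum_inner_products_le (v j) (s := Finset.univ)
          simp only [Real.norm_eq_abs, sq_abs] at h3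
          rw [hc]
          nlinarith [sq_nonneg δ]
      _ = n * (2 * δ ^ 2) := by simp
  have h := hS.det_le_pow htr
  rw [Matrix.det_mul, Matrix.det_mul, Matrix.det_transpose] at h
  nlinarith [mul_le_mul_of_nonneg_right hdet (sq_nonneg M.det)]

/-- If all `2 * k` successive distances are at least `s`, no `k`-dimensional subspace
approximates the vectors better than `s ^ 2 / 2`. -/
lemma sq_le_two_mul_of_le_infDist {H : Type*} [NormedAddCommGroup H] [InnerProductSpace ℝ H]
    {k : ℕ} (hk : 1 ≤ k) {v : Fin (2 * k) → H} (hv1 : ∀ j, ‖v j‖ ≤ 1) {s : ℝ} (hs : 0 < s)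
    (hs1 : s ≤ 1)
    (hvs : ∀ j, s ≤ infDist (v j) ((span ℝ (v '' Set.Iio j) : Submodule ℝ H) : Set H))
    (Y : Submodule ℝ H) [FiniteDimensional ℝ Y] (hY : Module.finrank ℝ Y ≤ k) {δ : ℝ} (hδ : 0 < δ)
    (hd : ∀ j, infDist (v j) (Y : Set H) ≤ δ) : s ^ 2 ≤ 2 * δ := by
  rcases le_or_gt 1 δ with hδ1 | hδ1
  · nlinarith
  set r := InnerProductSpace.gramSchmidt ℝ v with hr
  have hsr : ∀ j, s ≤ ‖r j‖ := by
    intro j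
    have hmem : v j - r j ∈ span ℝ (v '' Set.Iio j) := by
      rw [hr, InnerProductSpace.gramSchmidt_def, sub_sub_cancel,
        ← InnerProductSpace.span_gramSchmidt_Iio]
      refine Submodule.sum_mem _ fun i hi => ?_
      rw [Submodule.starProjection_singleton]
      exact Submodule.smul_mem _ _ (subset_span ⟨i, by simpa using hi, rfl⟩)
    refine (hvs j).trans ((infDist_le_dist_of_mem (y := v j - r j) hmem).trans ?_)
    simp
  have hr0 : ∀ j, r j ≠ 0 := fun j => norm_pos_iff.1 (hs.trans_le (hsr j))
  set q := InnerProductSpace.gramSchmidtNormed ℝ v with hq_def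
  have hqr : ∀ j, q j = ‖r j‖⁻¹ • r j := fun j => rfl
  have hq : Orthonormal ℝ q := by
    refine ⟨fun i => ?_, fun i j hij => ?_⟩
    · rw [hqr, norm_smul, norm_inv, norm_norm, inv_mul_cancel₀ (norm_ne_zero_iff.2 (hr0 i))]
    · change inner ℝ (q i) (q j) = 0
      rw [hqr, hqr, inner_smul_left, inner_smul_right, hr,
        InnerProductSpace.gramSchmidt_orthogonal ℝ v hij]
      simp
  have hspan : ∀ j, v j ∈ span ℝ (Set.range q) := by
    intro j
    rw [hq_def, InnerProductSpace.span_gramSchmidtNormed_range, InnerProductSpace.span_gramSchmidt]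
    exact subset_span ⟨j, rfl⟩
  have hmain := hq.pow_finrank_mul_det_sq_le hspan hv1 Y hδ.le hδ1.le hd
  have htri : (Matrix.of fun i j => inner ℝ (q i) (v j) :
      Matrix (Fin (2 * k)) (Fin (2 * k)) ℝ).IsUpperTriangular := by
    intro i j (hij : j < i)
    rw [Matrix.of_apply, hqr, inner_smul_left, hr,
      InnerProductSpace.gramSchmidt_inv_triangular ℝ v hij, mul_zero]
  have hdiag : ∀ j, inner ℝ (q j) (v j) = ‖r j‖ := by
    intro j
    have h1 : inner ℝ (r j) (v j) = ‖r j‖ ^ 2 := by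
      conv_lhs => rw [InnerProductSpace.gramSchmidt_def'' ℝ v j]
      rw [inner_add_right, inner_sum, Finset.sum_eq_zero, add_zero, real_inner_self_eq_norm_sq]
      intro i hi
      rw [inner_smul_right, hr, InnerProductSpace.gramSchmidt_orthogonal ℝ v
        (Finset.mem_Iio.1 hi).ne', mul_zero]
    rw [hqr, inner_smul_left, h1]
    have := norm_ne_zero_iff.2 (hr0 j)
    simp only [conj_trivial]
    field_simp
  have hdet : s ^ (2 * k) ≤ (Matrix.of fun i j => inner ℝ (q i) (v j) :
      Matrix (Fin (2 * k)) (Fin (2 * k)) ℝ).det := by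
    rw [Matrix.det_of_isUpperTriangular htri]
    calc s ^ (2 * k) = ∏ _i : Fin (2 * k), s := by simp
      _ ≤ _ := Finset.prod_le_prod (fun _ _ => hs.le) fun i _ => by
          rw [Matrix.of_apply, hdiag]; exact hsr i
  have hdet2 := pow_le_pow_left₀ (by positivity) hdet 2
  have hpow : (δ ^ 2) ^ k ≤ (δ ^ 2) ^ Module.finrank ℝ Y :=
    pow_le_pow_of_le_one (by positivity) (by nlinarith) hY
  have h1 : (δ ^ 2) ^ k * (s ^ (2 * k)) ^ 2 ≤ (2 * δ ^ 2) ^ (2 * k) :=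
    (mul_le_mul hpow hdet2 (by positivity) (by positivity)).trans hmain
  have h2 : (s ^ 2) ^ (2 * k) ≤ (2 * δ) ^ (2 * k) := by
    have e1 : (δ ^ 2) ^ k * (s ^ (2 * k)) ^ 2 = δ ^ (2 * k) * (s ^ 2) ^ (2 * k) := by ring
    have e2 : (2 * δ ^ 2) ^ (2 * k) = δ ^ (2 * k) * (2 * δ) ^ (2 * k) := by
      rw [← mul_pow]; ring
    rw [e1, e2] at h1
    exact le_of_mul_le_mul_left h1 (by positivity)
  exact le_of_pow_le_pow_left₀ (by omega) (by positivity) h2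

lemma infDist_submodule_le_norm {H : Type*} [NormedAddCommGroup H] [InnerProductSpace ℝ H]
    (Y : Submodule ℝ H) (g : H) : infDist g (Y : Set H) ≤ ‖g‖ := by
  simpa using infDist_le_dist_of_mem (x := g) Y.zero_mem

/-- Corollary 3.2 (iii): sub-exponential decay of widths implies sub-exponential decay of greedy errors. -/
theorem weak_greedy_hilbert_subexp
    {H : Type*} [NormedAddCommGroup H] [InnerProductSpace ℝ H] [CompleteSpace H]
    (γ : ℝ) (hγ0 : 0 < γ) (hγ1 : γ ≤ 1)
    (F : Set H) (hFc : IsCompact F) (hFb : ∀ g ∈ F, ‖g‖ ≤ 1)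
    (f : ℕ → H) (hfF : ∀ n, f n ∈ F)
    (σ : ℕ → ℝ)
    (hσ : ∀ n, σ n =
      sSup ((fun g => infDist g ((span ℝ (f '' Set.Iio n) : Submodule ℝ H) : Set H)) '' F))
    (hgreedy : ∀ n, γ * σ n ≤
      infDist (f n) ((span ℝ (f '' Set.Iio n) : Submodule ℝ H) : Set H))
    (d : ℕ → ℝ)
    (hd : ∀ m, d m =
      ⨅ Y : {Y : Submodule ℝ H // FiniteDimensional ℝ Y ∧ Module.finrank ℝ Y ≤ m},
        sSup ((fun g => infDist g ((Y : Submodule ℝ H) : Set H)) '' F))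
    (α C₀ c₀ : ℝ) (hα : 0 < α) (hC₀ : 0 < C₀) (hc₀ : 0 < c₀)
    (hdecay : ∀ n : ℕ, 1 ≤ n → d n ≤ C₀ * Real.exp (-c₀ * (n : ℝ) ^ α)) :
    ∀ n : ℕ, 2 ≤ n →
      σ n ≤ Real.sqrt (2 * C₀) * γ⁻¹ * Real.exp (-((2 : ℝ) ^ (-1 - 2 * α) * c₀) * (n : ℝ) ^ α) := by
  have hbdd : ∀ Y : Submodule ℝ H, BddAbove ((fun g => infDist g (Y : Set H)) '' F) := by
    rintro Y
    refine ⟨1, ?_⟩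
    rintro _ ⟨g, hg, rfl⟩
    exact (infDist_submodule_le_norm Y g).trans (hFb g hg)
  have hne : F.Nonempty := ⟨f 0, hfF 0⟩
  have hσ1 : ∀ n, σ n ≤ 1 := by
    intro n
    rw [hσ]
    refine csSup_le (hne.image _) ?_
    rintro _ ⟨g, hg, rfl⟩
    exact (infDist_submodule_le_norm _ g).trans (hFb g hg)
  have hanti : Antitone σ := by
    intro m n hmn
    rw [hσ, hσ]
    refine csSup_le (hne.image _) ?_
    rintro _ ⟨g, hg, rfl⟩
    exact (infDist_le_infDist_of_subset
      (span_mono (Set.image_mono (Set.Iio_subset_Iio hmn))) ⟨0, Submodule.zero_mem _⟩).trans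
      (le_csSup (hbdd _) ⟨g, hg, rfl⟩)
  have hwidth : ∀ k, 1 ≤ k → 0 < σ (2 * k) → (γ * σ (2 * k)) ^ 2 / 2 ≤ d k := by
    intro k hk hpos
    rw [hd]
    have : Nonempty {Y : Submodule ℝ H // FiniteDimensional ℝ Y ∧ Module.finrank ℝ Y ≤ k} :=
      ⟨⟨⊥, inferInstance, by simp⟩⟩
    refine le_ciInf fun ⟨Y, hYf, hYk⟩ => ?_
    have hYF : ∀ g ∈ F, infDist g (Y : Set H) ≤
        sSup ((fun g => infDist g (Y : Set H)) '' F) :=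
      fun g hg => le_csSup (hbdd Y) ⟨g, hg, rfl⟩
    refine le_of_forall_pos_le_add fun ε hε => ?_
    have h0 := infDist_nonneg.trans (hYF _ hne.some_mem)
    have := sq_le_two_mul_of_le_infDist hk (v := fun j : Fin (2 * k) => f j)
      (fun j => hFb _ (hfF _)) (s := γ * σ (2 * k)) (by positivity)
      (mul_le_one₀ hγ1 hpos.le (hσ1 _)) (fun j => ?_) Y hYk
      (δ := sSup ((fun g => infDist g (Y : Set H)) '' F) + ε) (by positivity)
      (fun j => (hYF _ (hfF _)).trans (by linarith))
    · change _ ≤ sSup ((fun g => infDist g (Y : Set H)) '' F) + ε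
      linarith
    · refine (mul_le_mul_of_nonneg_left (hanti j.2.le) hγ0.le).trans ((hgreedy j).trans ?_)
      refine infDist_le_infDist_of_subset (span_mono ?_) ⟨0, Submodule.zero_mem _⟩
      rintro _ ⟨i, hi, rfl⟩
      exact ⟨i, hi, rfl⟩
  intro n hn
  obtain ⟨k, hk, hkn, hnk⟩ : ∃ k, 1 ≤ k ∧ 2 * k ≤ n ∧ n ≤ 4 * k :=
    ⟨n / 2, by omega, by omega, by omega⟩
  refine (hanti hkn).trans ?_
  rcases le_or_gt (σ (2 * k)) 0 with h0 | hpos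
  · exact h0.trans (by positivity)
  have hexp : 2 * ((2 : ℝ) ^ (-1 - 2 * α) * c₀) * (n : ℝ) ^ α ≤ c₀ * (k : ℝ) ^ α := by
    have h1 : (n : ℝ) ^ α ≤ (2 : ℝ) ^ (2 * α) * (k : ℝ) ^ α := by
      rw [Real.rpow_mul (by norm_num), ← Real.mul_rpow (by positivity) (by positivity)]
      refine Real.rpow_le_rpow (by positivity) ?_ hα.le
      have : (n : ℝ) ≤ 4 * k := by exact_mod_cast hnk
      norm_num
      exact this
    have h2 : (2 : ℝ) ^ (-1 - 2 * α) * (2 : ℝ) ^ (2 * α) = 1 / 2 := by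
      rw [← Real.rpow_add (by norm_num), sub_add_cancel, Real.rpow_neg_one]
      norm_num
    calc 2 * ((2 : ℝ) ^ (-1 - 2 * α) * c₀) * (n : ℝ) ^ α
        ≤ 2 * ((2 : ℝ) ^ (-1 - 2 * α) * c₀) * ((2 : ℝ) ^ (2 * α) * (k : ℝ) ^ α) := by gcongr
      _ = 2 * ((2 : ℝ) ^ (-1 - 2 * α) * (2 : ℝ) ^ (2 * α)) * (c₀ * (k : ℝ) ^ α) := by ring
      _ = c₀ * (k : ℝ) ^ α := by rw [h2]; ring
  have hmain : (γ * σ (2 * k)) ^ 2 ≤ (Real.sqrt (2 * C₀) *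
      Real.exp (-((2 : ℝ) ^ (-1 - 2 * α) * c₀) * (n : ℝ) ^ α)) ^ 2 := by
    rw [mul_pow (Real.sqrt _), Real.sq_sqrt (by positivity), ← Real.exp_nat_mul]
    have h1 : (γ * σ (2 * k)) ^ 2 ≤ 2 * C₀ * Real.exp (-c₀ * (k : ℝ) ^ α) := by
      linarith [hwidth k hk hpos, hdecay k hk]
    refine h1.trans ?_
    refine mul_le_mul_of_nonneg_left (Real.exp_le_exp.2 ?_) (by positivity)
    push_cast
    linarith
  have := le_of_pow_le_pow_left₀ two_ne_zero (by positivity) hmain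
  rw [mul_right_comm, ← div_eq_mul_inv, le_div_iff₀ hγ0]
  linarith
end

section
/- For every ℓ ≥ 1, one has σ_{2ℓ} ≤ 2 · γ^{−1} · √(ℓ · d_ℓ). -/
open Metric Submodule

/-- Hadamard's inequality for the determinant of an endomorphism of a Euclidean space. -/
theorem LinearMap.abs_det_le_prod_norm_apply_orthonormalBasis {n : ℕ} {E : Type*}
    [NormedAddCommGroup E] [InnerProductSpace ℝ E] (T : E →ₗ[ℝ] E)
    (b : OrthonormalBasis (Fin n) ℝ E) : |LinearMap.det T| ≤ ∏ i, ‖T (b i)‖ := by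
  have : Fact (Module.finrank ℝ E = n) := ⟨by simpa using Module.finrank_eq_card_basis b.toBasis⟩
  have h := b.toBasis.orientation.abs_volumeForm_apply_le (T ∘ b)
  rw [Orientation.volumeForm_robust _ b rfl] at h
  have hdet : b.toBasis.det (T ∘ b) = LinearMap.det T := by
    rw [← b.coe_toBasis, Module.Basis.det_comp, Module.Basis.det_self, mul_one]
  simpa [hdet] using h

/-- The inequality of arithmetic and geometric means, in product form. -/
theorem Finset.prod_le_pow_sum_div_card {ι : Type*} (s : Finset ι) (hs : s.Nonempty) (z : ι → ℝ)
    (hz : ∀ i ∈ s, 0 ≤ z i) : ∏ i ∈ s, z i ≤ ((∑ i ∈ s, z i) / s.card) ^ s.card := by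
  have hc : (0 : ℝ) < s.card := by exact_mod_cast hs.card_pos
  have h := Real.geom_mean_le_arith_mean s (fun _ => 1) z (fun _ _ => zero_le_one) (by simpa) hz
  simp only [Real.rpow_one, Finset.sum_const, nsmul_eq_mul, mul_one, one_mul] at h
  have hp := Finset.prod_nonneg hz
  calc ∏ i ∈ s, z i = ((∏ i ∈ s, z i) ^ (s.card : ℝ)⁻¹) ^ s.card :=
        (Real.rpow_inv_natCast_pow hp hs.card_pos.ne').symm
    _ ≤ _ := by gcongr

/-- The Hilbert–Schmidt norm, computed in any orthonormal basis, is controlled by the largest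
entry. -/
theorem Matrix.sum_norm_toEuclideanLin_apply_sq_le {ι κ : Type*} [Fintype ι] [DecidableEq ι]
    [Fintype κ] (A : Matrix ι ι ℝ) {c : ℝ} (hA : ∀ i j, |A i j| ≤ c)
    (b : OrthonormalBasis κ ℝ (EuclideanSpace ℝ ι)) :
    ∑ j, ‖Matrix.toEuclideanLin A (b j)‖ ^ 2 ≤ (Fintype.card ι * c) ^ 2 := by
  have key : ∀ i j, Matrix.toEuclideanLin A (b j) i = inner ℝ (b j) (WithLp.toLp 2 (A i)) := by
    intro i j
    simp [Matrix.toLpLin_apply, Matrix.mulVec, dotProduct, PiLp.inner_apply]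
  calc ∑ j, ‖Matrix.toEuclideanLin A (b j)‖ ^ 2
      = ∑ i, ∑ j, ‖inner ℝ (b j) (WithLp.toLp 2 (A i))‖ ^ 2 := by
        simp_rw [EuclideanSpace.norm_sq_eq, key]
        exact Finset.sum_comm
    _ = ∑ i, ∑ j, |A i j| ^ 2 := by
        simp_rw [b.sum_sq_norm_inner_right, EuclideanSpace.norm_sq_eq, Real.norm_eq_abs]
    _ ≤ ∑ _i : ι, ∑ _j : ι, c ^ 2 := by
        gcongr with i _ j _
        exact hA i j
    _ = (Fintype.card ι * c) ^ 2 := by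
        simp only [Finset.sum_const, Finset.card_univ, nsmul_eq_mul]
        ring

/-- If a matrix with entries in `[-1, 1]` agrees, on a subspace of at least half the dimension, with
a matrix whose entries are at most `δ` in absolute value, then its determinant is small. -/
theorem Matrix.abs_det_le_of_eqOn {l : ℕ} (hl : 1 ≤ l) (A C : Matrix (Fin (2 * l)) (Fin (2 * l)) ℝ)
    {δ : ℝ} (hδ : 0 ≤ δ) (hA : ∀ i j, |A i j| ≤ 1) (hC : ∀ i j, |C i j| ≤ δ)
    (N : Submodule ℝ (EuclideanSpace ℝ (Fin (2 * l)))) (hN : l ≤ Module.finrank ℝ N)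
    (hAC : ∀ v ∈ N, Matrix.toEuclideanLin A v = Matrix.toEuclideanLin C v) :
    |A.det| ≤ (4 * l * δ) ^ l := by
  let e := stdOrthonormalBasis ℝ N
  let v : Fin (2 * l) → EuclideanSpace ℝ (Fin (2 * l)) := fun i =>
    if h : (i : ℕ) < l then e ⟨i, h.trans_le hN⟩ else 0
  let s : Finset (Fin (2 * l)) := {i | (i : ℕ) < l}
  have hs : s.card = l := by
    rw [Fin.card_filter_val_lt]
    omega
  have hsc : sᶜ.card = l := by
    rw [Finset.card_compl, hs, Fintype.card_fin]
    omega
  have hlt : ∀ i ∈ s, (i : ℕ) < l := fun i hi => (Finset.mem_filter.1 hi).2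
  have hv : Orthonormal ℝ ((s : Set (Fin (2 * l))).domRestrict v) := by
    have h := (e.orthonormal.comp (fun i : (s : Set (Fin (2 * l))) =>
      (⟨(i : Fin (2 * l)), (hlt i i.2).trans_le hN⟩ : Fin (Module.finrank ℝ N)))
      (fun i j hij => Subtype.ext (Fin.ext (by simpa using hij)))).comp_linearIsometry
        N.subtypeₗᵢ
    convert h using 1
    ext1 i
    exact dif_pos (hlt i i.2)
  obtain ⟨b, hb⟩ := hv.exists_orthonormalBasis_extension_of_card_eq (by simp)
  have hbN : ∀ i ∈ s, b i ∈ N := by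
    intro i hi
    rw [hb i hi]
    simp [v, hlt i hi]
  have hl0 : (0 : ℝ) < l := by exact_mod_cast hl
  have bound : ∀ (M : Matrix (Fin (2 * l)) (Fin (2 * l)) ℝ) (c : ℝ) (t : Finset (Fin (2 * l))),
      (∀ i j, |M i j| ≤ c) → t.card = l →
      ∏ i ∈ t, ‖Matrix.toEuclideanLin M (b i)‖ ^ 2 ≤ (4 * l * c ^ 2) ^ l := by
    intro M c t hM ht
    calc ∏ i ∈ t, ‖Matrix.toEuclideanLin M (b i)‖ ^ 2
        ≤ ((∑ i ∈ t, ‖Matrix.toEuclideanLin M (b i)‖ ^ 2) / t.card) ^ t.card :=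
          Finset.prod_le_pow_sum_div_card t (Finset.card_pos.1 (by omega)) _
            fun _ _ => sq_nonneg _
      _ ≤ ((2 * l * c) ^ 2 / l) ^ l := by
          rw [ht]
          gcongr
          refine (Finset.sum_le_univ_sum_of_nonneg fun _ => sq_nonneg _).trans ?_
          simpa using M.sum_norm_toEuclideanLin_apply_sq_le hM b
      _ = (4 * l * c ^ 2) ^ l := by
          congr 1
          field_simp
          ring
  have hdet : |A.det| ≤ ∏ i, ‖Matrix.toEuclideanLin A (b i)‖ := by
    have h := (Matrix.toEuclideanLin A).abs_det_le_prod_norm_apply_orthonormalBasis b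
    rwa [Matrix.toEuclideanLin_eq_toLin_orthonormal, LinearMap.det_toLin] at h
  refine le_of_sq_le_sq ?_ (by positivity)
  calc |A.det| ^ 2 ≤ (∏ i, ‖Matrix.toEuclideanLin A (b i)‖) ^ 2 := by gcongr
    _ = (∏ i ∈ s, ‖Matrix.toEuclideanLin C (b i)‖ ^ 2) *
          ∏ i ∈ sᶜ, ‖Matrix.toEuclideanLin A (b i)‖ ^ 2 := by
        rw [← Finset.prod_pow, ← Finset.prod_mul_prod_compl s]
        congr 1
        exact Finset.prod_congr rfl fun i hi => by rw [hAC _ (hbN i hi)]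
    _ ≤ (4 * l * δ ^ 2) ^ l * (4 * l * 1 ^ 2) ^ l := by
        gcongr
        · exact bound C δ s hC hs
        · exact bound A 1 sᶜ hA hsc
    _ = ((4 * l * δ) ^ l) ^ 2 := by
        rw [← mul_pow, ← pow_mul, mul_comm l 2, pow_mul]
        congr 1
        ring

/-- Hahn–Banach: the distance to a subspace is attained by a functional of norm at most one
vanishing on the subspace. -/
theorem Submodule.exists_strongDual_eq_infDist {X : Type*} [NormedAddCommGroup X] [NormedSpace ℝ X]
    (V : Submodule ℝ X) (x : X) :
    ∃ g : StrongDual ℝ X, ‖g‖ ≤ 1 ∧ (∀ v ∈ V, g v = 0) ∧ g x = infDist x (V : Set X) := by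
  obtain ⟨g, hg, hgx⟩ := exists_dual_vector'' ℝ (V.mkQ x)
  have hnorm : ∀ y, ‖V.mkQ y‖ = infDist y (V : Set X) := fun y =>
    QuotientAddGroup.norm_mk (S := V.toAddSubgroup) y
  have hle : ∀ y, ‖(g.toLinearMap ∘ₗ V.mkQ) y‖ ≤ 1 * ‖y‖ := by
    intro y
    calc ‖g (V.mkQ y)‖ ≤ ‖g‖ * ‖V.mkQ y‖ := g.le_opNorm _
      _ ≤ 1 * ‖y‖ := by
        gcongr
        rw [hnorm]
        simpa using infDist_le_dist_of_mem (x := y) V.zero_mem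
  refine ⟨(g.toLinearMap ∘ₗ V.mkQ).mkContinuous 1 hle,
    LinearMap.mkContinuous_norm_le _ zero_le_one _, fun v hv => ?_, ?_⟩
  · simp [(Submodule.Quotient.mk_eq_zero V).2 hv]
  · have := hgx.trans (hnorm x)
    simpa using this

/-- The product of the greedy distances is controlled by the distance to any subspace of dimension
at most half the number of steps. -/
theorem prod_infDist_span_le {X : Type*} [NormedAddCommGroup X] [NormedSpace ℝ X] (f : ℕ → X)
    (hf : ∀ n, ‖f n‖ ≤ 1) {l : ℕ} (hl : 1 ≤ l) (Y : Submodule ℝ X) [FiniteDimensional ℝ Y]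
    (hY : Module.finrank ℝ Y ≤ l) {δ : ℝ} (hδ : 0 ≤ δ)
    (hfY : ∀ n, infDist (f n) (Y : Set X) < δ) :
    ∏ n : Fin (2 * l), infDist (f n) (span ℝ (f '' Set.Iio (n : ℕ)) : Set X) ≤
      (4 * l * δ) ^ l := by
  choose g hg hgV hgf using fun n : ℕ =>
    (span ℝ (f '' Set.Iio n)).exists_strongDual_eq_infDist (f n)
  choose y hyY hy using fun n => (infDist_lt_iff ⟨0, Y.zero_mem⟩).1 (hfY n)
  let A : Matrix (Fin (2 * l)) (Fin (2 * l)) ℝ := .of fun i j => g j (f i)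
  let C : Matrix (Fin (2 * l)) (Fin (2 * l)) ℝ := .of fun i j => g j (f i - y i)
  let Φ : EuclideanSpace ℝ (Fin (2 * l)) →ₗ[ℝ] Module.Dual ℝ Y :=
    ∑ j, (EuclideanSpace.projₗ j).smulRight ((g j).toLinearMap ∘ₗ Y.subtype)
  have hle : ∀ n x, |g n x| ≤ ‖x‖ := fun n x => by
    simpa using (g n).le_of_opNorm_le (hg n) x
  have hker : l ≤ Module.finrank ℝ (LinearMap.ker Φ) := by
    have h1 := Φ.finrank_range_add_finrank_ker
    have h2 := (LinearMap.range Φ).finrank_le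
    rw [Subspace.dual_finrank_eq] at h2
    rw [finrank_euclideanSpace_fin] at h1
    omega
  have hAC : ∀ v ∈ LinearMap.ker Φ, Matrix.toEuclideanLin A v = Matrix.toEuclideanLin C v := by
    intro v hv
    ext i
    have h := LinearMap.congr_fun (LinearMap.mem_ker.1 hv) ⟨y i, hyY i⟩
    simp only [Φ, LinearMap.sum_apply, LinearMap.smulRight_apply, LinearMap.smul_apply,
      LinearMap.comp_apply, Submodule.subtype_apply, LinearMap.zero_apply, smul_eq_mul] at h
    simp only [Matrix.toLpLin_apply, Matrix.mulVec, dotProduct, A, C, Matrix.of_apply, map_sub,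
      sub_mul, Finset.sum_sub_distrib]
    rw [eq_comm, sub_eq_self, ← h]
    exact Finset.sum_congr rfl fun j _ => mul_comm _ _
  have hdet := Matrix.abs_det_le_of_eqOn hl A C hδ (fun i j => (hle _ _).trans (hf i))
    (fun i j => (hle _ _).trans (by simpa [dist_eq_norm] using (hy i).le)) _ hker hAC
  rw [Matrix.det_of_isLowerTriangular A fun i j hij =>
    hgV j _ (subset_span ⟨i, hij, rfl⟩)] at hdet
  simp only [A, Matrix.of_apply, hgf] at hdet
  exact (le_abs_self _).trans hdet

/-- Corollary 4.2 (i), particular case: `σ_{2ℓ} ≤ 2 γ⁻¹ √(ℓ d_ℓ)`. -/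
theorem weak_greedy_banach_sqrt
    {X : Type*} [NormedAddCommGroup X] [NormedSpace ℝ X] [CompleteSpace X]
    (γ : ℝ) (hγ0 : 0 < γ) (hγ1 : γ ≤ 1)
    (F : Set X) (hFc : IsCompact F) (hFb : ∀ g ∈ F, ‖g‖ ≤ 1)
    (f : ℕ → X) (hfF : ∀ n, f n ∈ F)
    (σ : ℕ → ℝ)
    (hσ : ∀ n, σ n =
      sSup ((fun g => infDist g ((span ℝ (f '' Set.Iio n) : Submodule ℝ X) : Set X)) '' F))
    (hgreedy : ∀ n, γ * σ n ≤
      infDist (f n) ((span ℝ (f '' Set.Iio n) : Submodule ℝ X) : Set X))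
    (d : ℕ → ℝ)
    (hd : ∀ m, d m =
      ⨅ Y : {Y : Submodule ℝ X // FiniteDimensional ℝ Y ∧ Module.finrank ℝ Y ≤ m},
        sSup ((fun g => infDist g ((Y : Submodule ℝ X) : Set X)) '' F))
    (l : ℕ) (hl : 1 ≤ l) :
    σ (2 * l) ≤ 2 * γ⁻¹ * Real.sqrt (l * d l) := by
  have hF : F.Nonempty := ⟨f 0, hfF 0⟩
  have hle_one : ∀ (V : Submodule ℝ X), ∀ g ∈ F, infDist g (V : Set X) ≤ 1 := fun V g hg =>
    (infDist_le_dist_of_mem V.zero_mem).trans (by simpa using hFb g hg)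
  have hbdd : ∀ V : Submodule ℝ X, BddAbove ((fun g => infDist g (V : Set X)) '' F) := fun V =>
    ⟨1, by rintro _ ⟨g, hg, rfl⟩; exact hle_one V g hg⟩
  have hsup : ∀ (V : Submodule ℝ X), ∀ g ∈ F,
      infDist g (V : Set X) ≤ sSup ((fun g => infDist g (V : Set X)) '' F) := fun V g hg =>
    le_csSup (hbdd V) ⟨g, hg, rfl⟩
  have hσ0 : ∀ n, 0 ≤ σ n := fun n => by
    rw [hσ]
    exact infDist_nonneg.trans (hsup _ _ (hfF 0))
  have hσanti : Antitone σ := by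
    intro m n hmn
    rw [hσ, hσ]
    refine csSup_le (hF.image _) ?_
    rintro _ ⟨g, hg, rfl⟩
    refine le_trans ?_ (hsup _ g hg)
    exact infDist_le_infDist_of_subset
      (span_mono (Set.image_mono (Set.Iio_subset_Iio hmn))) ⟨0, zero_mem _⟩
  have : Nonempty {Y : Submodule ℝ X // FiniteDimensional ℝ Y ∧ Module.finrank ℝ Y ≤ l} :=
    ⟨⟨⊥, inferInstance, by simp⟩⟩
  have hd0 : 0 ≤ d l := by
    rw [hd]
    exact le_ciInf fun Y => infDist_nonneg.trans (hsup Y _ (hfF 0))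
  have hδ : ∀ δ, d l < δ → (γ * σ (2 * l)) ^ 2 ≤ 4 * l * δ := by
    intro δ hlt
    have hδ0 := hd0.trans hlt.le
    rw [hd] at hlt
    obtain ⟨⟨Y, hYfin, hYrank⟩, hY⟩ := exists_lt_of_ciInf_lt hlt
    have h := prod_infDist_span_le f (fun n => hFb _ (hfF n)) hl Y hYrank hδ0
      fun n => (hsup Y _ (hfF n)).trans_lt hY
    refine le_of_pow_le_pow_left₀ (n := l) (by omega) (by positivity) ?_
    calc ((γ * σ (2 * l)) ^ 2) ^ l = ∏ _n : Fin (2 * l), γ * σ (2 * l) := by simp [pow_mul]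
      _ ≤ ∏ n : Fin (2 * l), infDist (f n) (span ℝ (f '' Set.Iio (n : ℕ)) : Set X) := by
        refine Finset.prod_le_prod (fun _ _ => mul_nonneg hγ0.le (hσ0 _)) fun n _ => ?_
        exact (mul_le_mul_of_nonneg_left (hσanti n.2.le) hγ0.le).trans (hgreedy n)
      _ ≤ _ := h
  have hl0 : (0 : ℝ) < l := by exact_mod_cast hl
  have hsq : (γ * σ (2 * l)) ^ 2 ≤ 4 * l * d l := by
    rw [← div_le_iff₀' (by positivity)]
    refine le_of_forall_gt_imp_ge_of_dense fun δ h => ?_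
    rw [div_le_iff₀' (by positivity)]
    exact hδ δ h
  have hsqrt : γ * σ (2 * l) ≤ 2 * Real.sqrt (l * d l) := by
    refine le_of_sq_le_sq ?_ (by positivity)
    rw [mul_pow 2, Real.sq_sqrt (by positivity)]
    linarith
  calc σ (2 * l) = γ⁻¹ * (γ * σ (2 * l)) := by field_simp
    _ ≤ γ⁻¹ * (2 * Real.sqrt (l * d l)) := by gcongr
    _ = 2 * γ⁻¹ * Real.sqrt (l * d l) := by ring
end

section
/- For every n ≥ 2 and every 1 ≤ m < n, one has σ_{2n} ≤ √(2n) · γ^{−1} · σ_n^{δ} · d_m^{1−δ}, where δ := m/n. -/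
open Metric Submodule

theorem prod_le_arith_mean_pow {ι : Type*} [Fintype ι] [Nonempty ι] (z : ι → ℝ)
    (hz : ∀ i, 0 ≤ z i) : ∏ i, z i ≤ ((∑ i, z i) / Fintype.card ι) ^ Fintype.card ι := by
  have hc : (0 : ℝ) < Fintype.card ι := by exact_mod_cast Fintype.card_pos
  have h := Real.geom_mean_le_arith_mean Finset.univ (fun _ : ι => (1 : ℝ)) z
    (fun _ _ => zero_le_one) (by simpa using hc) (fun i _ => hz i)
  simp only [Real.rpow_one, one_mul, Finset.sum_const, Finset.card_univ, nsmul_eq_mul,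
    mul_one] at h
  have hp : 0 ≤ ∏ i, z i := Finset.prod_nonneg fun i _ => hz i
  calc ∏ i, z i = ((∏ i, z i) ^ ((Fintype.card ι : ℝ)⁻¹)) ^ Fintype.card ι :=
        (Real.rpow_inv_natCast_pow hp Fintype.card_ne_zero).symm
    _ ≤ _ := pow_le_pow_left₀ (Real.rpow_nonneg hp _) h _

/-- A Frobenius-norm form of Hadamard's determinant inequality. -/
theorem Matrix.det_sq_le_arith_mean_pow {ι : Type*} [Fintype ι] [DecidableEq ι] [Nonempty ι]
    (M : Matrix ι ι ℝ) :
    M.det ^ 2 ≤ ((∑ j, ∑ i, M i j ^ 2) / Fintype.card ι) ^ Fintype.card ι := by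
  have hpos : (M.transpose * M).PosSemidef := by
    simpa using Matrix.posSemidef_conjTranspose_mul_self M
  have hdet : M.det ^ 2 = ∏ i, hpos.isHermitian.eigenvalues i := by
    have := hpos.isHermitian.det_eq_prod_eigenvalues
    simpa [Matrix.det_mul, sq] using this
  have htr : ∑ j, ∑ i, M i j ^ 2 = ∑ i, hpos.isHermitian.eigenvalues i := by
    have := hpos.isHermitian.trace_eq_sum_eigenvalues
    simpa [Matrix.trace, Matrix.mul_apply, sq] using this
  rw [hdet, htr]
  exact prod_le_arith_mean_pow _ hpos.eigenvalues_nonneg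

theorem OrthonormalBasis.det_sq_le_arith_mean_pow {ι E : Type*} [Fintype ι] [Nonempty ι]
    [NormedAddCommGroup E] [InnerProductSpace ℝ E] (b : OrthonormalBasis ι ℝ E) (A : E →ₗ[ℝ] E) :
    LinearMap.det A ^ 2 ≤ ((∑ j, ‖A (b j)‖ ^ 2) / Fintype.card ι) ^ Fintype.card ι := by
  classical
  rw [← LinearMap.det_toMatrix b.toBasis]
  convert Matrix.det_sq_le_arith_mean_pow (LinearMap.toMatrix b.toBasis b.toBasis A) using 5
    with j
  rw [← b.sum_sq_norm_inner_right]
  simp [LinearMap.toMatrix_apply, b.repr_apply_apply]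

theorem Submodule.det_smul_starProjection_add_smul {E : Type*} [NormedAddCommGroup E]
    [InnerProductSpace ℝ E] [FiniteDimensional ℝ E] (W : Submodule ℝ E) (s t : ℝ) :
    LinearMap.det ((s • W.starProjection + t • Wᗮ.starProjection : E →L[ℝ] E) : E →ₗ[ℝ] E) =
      s ^ Module.finrank ℝ W * t ^ Module.finrank ℝ Wᗮ := by
  let e := W.prodEquivOfIsCompl _ W.isCompl_orthogonal
  have h : ((s • W.starProjection + t • Wᗮ.starProjection : E →L[ℝ] E) : E →ₗ[ℝ] E) =
      (e : _ →ₗ[ℝ] E) ∘ₗ ((s • LinearMap.id).prodMap (t • LinearMap.id)) ∘ₗ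
        (e.symm : E →ₗ[ℝ] W × Wᗮ) := by
    rw [← LinearMap.comp_assoc, LinearEquiv.eq_comp_toLinearMap_symm]
    ext x
    · have h0 : Wᗮ.starProjection (x : E) = 0 := by
        rw [starProjection_apply_eq_zero_iff, orthogonal_orthogonal]; exact x.2
      simp [e, h0, starProjection_eq_self_iff.mpr x.2]
    · have h0 : W.starProjection (x : E) = 0 := by
        rw [starProjection_apply_eq_zero_iff]; exact x.2
      simp [e, h0, starProjection_eq_self_iff.mpr x.2]
  rw [h, LinearMap.det_conj, LinearMap.det_prodMap]
  simp

/-- If an endomorphism sends an orthonormal basis to vectors that are bounded by `√C S` and within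
`√C D` of a subspace of dimension at most `m`, its determinant is correspondingly small. -/
theorem OrthonormalBasis.det_sq_le_of_near_subspace {ι E : Type*} [Fintype ι] [Nonempty ι]
    [NormedAddCommGroup E] [InnerProductSpace ℝ E] (b : OrthonormalBasis ι ℝ E) (A : E →ₗ[ℝ] E)
    (W : Submodule ℝ E) {m : ℕ} (hW : Module.finrank ℝ W ≤ m) (hm : m ≤ Fintype.card ι)
    {C S D : ℝ} (hD : 0 < D) (hDS : D ≤ S) (hS : ∀ j, ‖A (b j)‖ ^ 2 ≤ C * S ^ 2)
    (hA : ∀ j, ∃ w ∈ W, ‖A (b j) - w‖ ^ 2 ≤ C * D ^ 2) :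
    LinearMap.det A ^ 2 ≤ (2 * C) ^ Fintype.card ι * (S ^ m * D ^ (Fintype.card ι - m)) ^ 2 := by
  have : FiniteDimensional ℝ E := b.toBasis.finiteDimensional_of_finite
  have hS0 : 0 < S := hD.trans_le hDS
  have hcard : Module.finrank ℝ W + Module.finrank ℝ Wᗮ = Fintype.card ι := by
    rw [W.finrank_add_finrank_orthogonal, Module.finrank_eq_card_basis b.toBasis]
  have hc : (0 : ℝ) < Fintype.card ι := by exact_mod_cast Fintype.card_pos
  set T : E →L[ℝ] E := S⁻¹ • W.starProjection + D⁻¹ • Wᗮ.starProjection with hT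
  have hTA (j) : ‖T (A (b j))‖ ^ 2 ≤ 2 * C := by
    set v := A (b j)
    have h1 : ‖T v‖ ^ 2 = (S⁻¹ * ‖W.starProjection v‖) ^ 2 +
        (D⁻¹ * ‖Wᗮ.starProjection v‖) ^ 2 := by
      have : T v = S⁻¹ • W.starProjection v + D⁻¹ • Wᗮ.starProjection v := rfl
      rw [this, sq, norm_add_sq_eq_norm_sq_add_norm_sq_real]
      · simp only [norm_smul, Real.norm_eq_abs, abs_of_pos (inv_pos.2 hS0),
          abs_of_pos (inv_pos.2 hD)]
        ring
      · simp only [inner_smul_left, inner_smul_right]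
        rw [inner_right_of_mem_orthogonal (K := W) (starProjection_apply_mem _ _)
          (starProjection_apply_mem _ _)]
        simp
    have h2 : ‖W.starProjection v‖ ^ 2 ≤ C * S ^ 2 :=
      (pow_le_pow_left₀ (norm_nonneg _) (W.norm_starProjection_apply_le v) 2).trans (hS j)
    have h3 : ‖Wᗮ.starProjection v‖ ^ 2 ≤ C * D ^ 2 := by
      obtain ⟨w, hw, hvw⟩ := hA j
      have hw0 : Wᗮ.starProjection w = 0 := by
        rw [starProjection_apply_eq_zero_iff, orthogonal_orthogonal]; exact hw
      have : Wᗮ.starProjection v = Wᗮ.starProjection (v - w) := by rw [map_sub, hw0, sub_zero]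
      rw [this]
      exact (pow_le_pow_left₀ (norm_nonneg _) (Wᗮ.norm_starProjection_apply_le _) 2).trans hvw
    rw [h1, mul_pow, mul_pow, inv_pow, inv_pow, two_mul]
    gcongr
    · rw [inv_mul_le_iff₀ (by positivity)]; linarith
    · rw [inv_mul_le_iff₀ (by positivity)]; linarith
  have hdet := b.det_sq_le_arith_mean_pow ((T : E →ₗ[ℝ] E) ∘ₗ A)
  rw [LinearMap.det_comp, hT, det_smul_starProjection_add_smul, ← hT] at hdet
  have hsum : (∑ j, ‖((T : E →ₗ[ℝ] E) ∘ₗ A) (b j)‖ ^ 2) / Fintype.card ι ≤ 2 * C := by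
    rw [div_le_iff₀ hc]
    calc _ ≤ ∑ _j : ι, 2 * C := Finset.sum_le_sum fun j _ => hTA j
      _ = _ := by simp; ring
  have hdet' := hdet.trans (pow_le_pow_left₀ (by positivity) hsum _)
  rw [mul_pow, mul_comm, ← le_div_iff₀ (by positivity), div_eq_mul_inv, ← inv_pow, mul_inv,
    inv_pow, inv_pow, inv_inv, inv_inv] at hdet'
  have hC : 0 ≤ 2 * C := le_trans (by positivity) hsum
  refine hdet'.trans ?_
  refine mul_le_mul_of_nonneg_left (pow_le_pow_left₀ (by positivity) ?_ 2) (by positivity)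
  obtain ⟨k, hk⟩ := Nat.exists_eq_add_of_le hW
  have hp : Module.finrank ℝ Wᗮ = k + (Fintype.card ι - m) := by omega
  rw [hp, hk, pow_add, pow_add, mul_assoc]
  gcongr

/-- Hahn–Banach: a norm-attaining functional of the quotient by `V`, pulled back. -/
theorem Submodule.exists_dual_le_infDist {X : Type*} [NormedAddCommGroup X] [NormedSpace ℝ X]
    (V : Submodule ℝ X) (x : X) :
    ∃ φ : X →ₗ[ℝ] ℝ, φ x = infDist x (V : Set X) ∧ ∀ y, |φ y| ≤ infDist y (V : Set X) := by
  obtain ⟨g, hg, hgx⟩ := exists_dual_vector'' ℝ (V.mkQ x)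
  have hn (y : X) : ‖V.mkQ y‖ = infDist y (V : Set X) :=
    QuotientAddGroup.norm_mk (S := V.toAddSubgroup) y
  refine ⟨g.toLinearMap ∘ₗ V.mkQ, ?_, fun y => ?_⟩
  · rw [← hn x]; exact hgx
  · rw [← hn y]
    simpa using g.le_of_opNorm_le hg (V.mkQ y)

theorem prod_infDist_sq_le_of_near_subspace {X : Type*} [NormedAddCommGroup X] [NormedSpace ℝ X]
    {n m : ℕ} (hm : m ≤ n) (g : Fin n → X) (V : Fin n → Submodule ℝ X)
    (hV : ∀ i j, j < i → g j ∈ V i) (Y : Submodule ℝ X) [FiniteDimensional ℝ Y]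
    (hY : Module.finrank ℝ Y ≤ m) {S D : ℝ} (hD : 0 < D) (hDS : D ≤ S)
    (hS : ∀ i j, infDist (g j) (V i : Set X) ≤ S) (hg : ∀ j, ∃ y ∈ Y, ‖g j - y‖ ≤ D) :
    (∏ i, infDist (g i) (V i : Set X)) ^ 2 ≤ (2 * n : ℝ) ^ n * (S ^ m * D ^ (n - m)) ^ 2 := by
  rcases Nat.eq_zero_or_pos n with rfl | hn
  · obtain rfl : m = 0 := by omega
    simp
  have : Nonempty (Fin n) := ⟨⟨0, hn⟩⟩
  choose φ hφ hφle using fun i => (V i).exists_dual_le_infDist (g i)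
  let L : X →ₗ[ℝ] EuclideanSpace ℝ (Fin n) :=
    (WithLp.linearEquiv 2 ℝ (Fin n → ℝ)).symm.toLinearMap ∘ₗ LinearMap.pi φ
  have hL (x : X) {r : ℝ} (hx : ∀ i, |φ i x| ≤ r) : ‖L x‖ ^ 2 ≤ n * r ^ 2 := by
    rw [EuclideanSpace.norm_sq_eq]
    calc ∑ i, ‖L x i‖ ^ 2 ≤ ∑ _i : Fin n, r ^ 2 :=
          Finset.sum_le_sum fun i _ => pow_le_pow_left₀ (norm_nonneg _) (hx i) 2
      _ = n * r ^ 2 := by simp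
  let b := EuclideanSpace.basisFun (Fin n) ℝ
  let A := b.toBasis.constr ℝ fun j => L (g j)
  have hAb (j) : A (b j) = L (g j) := by
    have := b.toBasis.constr_basis ℝ (fun j => L (g j)) j
    rwa [b.coe_toBasis] at this
  have hM (i j) : LinearMap.toMatrix b.toBasis b.toBasis A i j = φ i (g j) := by
    rw [LinearMap.toMatrix_apply, b.coe_toBasis, hAb]
    rfl
  have hdet : LinearMap.det A = ∏ i, infDist (g i) (V i : Set X) := by
    rw [← LinearMap.det_toMatrix b.toBasis, Matrix.det_of_isUpperTriangular]
    · simp [hM, hφ]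
    · intro i j hij
      rw [hM]
      have := hφle i (g j)
      rw [infDist_zero_of_mem (hV i j hij)] at this
      exact abs_nonpos_iff.1 this
  rw [← hdet]
  have key := b.det_sq_le_of_near_subspace A (Y.map L) (m := m) (C := n) (S := S) (D := D)
    ((finrank_map_le L Y).trans hY) (by simpa using hm) hD hDS
    (fun j => by rw [hAb]; exact hL _ fun i => (hφle i _).trans (hS i j))
    (fun j => by
      obtain ⟨y, hy, hyD⟩ := hg j
      refine ⟨L y, mem_map_of_mem hy, ?_⟩
      rw [hAb, ← map_sub]
      refine hL _ fun i => (hφle i _).trans (le_trans ?_ hyD)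
      simpa using infDist_le_dist_of_mem (x := g j - y) (V i).zero_mem)
  simpa using key

/-- Inequality (4.9): `σ_{2n} ≤ √(2n) γ⁻¹ σ_n^δ d_m^{1-δ}` with `δ = m/n`. -/
theorem weak_greedy_banach_recursive
    {X : Type*} [NormedAddCommGroup X] [NormedSpace ℝ X] [CompleteSpace X]
    (γ : ℝ) (hγ0 : 0 < γ) (hγ1 : γ ≤ 1)
    (F : Set X) (hFc : IsCompact F) (hFb : ∀ g ∈ F, ‖g‖ ≤ 1)
    (f : ℕ → X) (hfF : ∀ n, f n ∈ F)
    (σ : ℕ → ℝ)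
    (hσ : ∀ n, σ n =
      sSup ((fun g => infDist g ((span ℝ (f '' Set.Iio n) : Submodule ℝ X) : Set X)) '' F))
    (hgreedy : ∀ n, γ * σ n ≤
      infDist (f n) ((span ℝ (f '' Set.Iio n) : Submodule ℝ X) : Set X))
    (d : ℕ → ℝ)
    (hd : ∀ m, d m =
      ⨅ Y : {Y : Submodule ℝ X // FiniteDimensional ℝ Y ∧ Module.finrank ℝ Y ≤ m},
        sSup ((fun g => infDist g ((Y : Submodule ℝ X) : Set X)) '' F))
    (n m : ℕ) (hn : 2 ≤ n) (hm : 1 ≤ m) (hmn : m < n) :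
    σ (2 * n) ≤ Real.sqrt (2 * n) * γ⁻¹ * σ n ^ ((m : ℝ) / n) * d m ^ (1 - (m : ℝ) / n) := by
  have hle (Y : Submodule ℝ X) {g : X} (hg : g ∈ F) : infDist g (Y : Set X) ≤
      sSup ((fun g => infDist g (Y : Set X)) '' F) := by
    refine le_csSup ⟨1, ?_⟩ ⟨g, hg, rfl⟩
    rintro _ ⟨h, hh, rfl⟩
    have := infDist_le_dist_of_mem (x := h) Y.zero_mem
    rw [dist_zero_right] at this
    exact this.trans (hFb h hh)
  have hsup0 (Y : Submodule ℝ X) : 0 ≤ sSup ((fun g => infDist g (Y : Set X)) '' F) :=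
    infDist_nonneg.trans (hle Y (hfF 0))
  have hσ0 (k) : 0 ≤ σ k := hσ k ▸ hsup0 _
  have hσle (k) {g : X} (hg : g ∈ F) :
      infDist g (span ℝ (f '' Set.Iio k) : Set X) ≤ σ k := hσ k ▸ hle _ hg
  have hσanti : Antitone σ := by
    intro k l hkl
    rw [hσ l]
    refine csSup_le ⟨_, f 0, hfF 0, rfl⟩ ?_
    rintro _ ⟨g, hg, rfl⟩
    refine (infDist_le_infDist_of_subset ?_ ⟨0, zero_mem _⟩).trans (hσle k hg)
    exact span_mono (Set.image_mono (Set.Iio_subset_Iio hkl))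
  have hd0 : 0 ≤ d m := hd m ▸ Real.iInf_nonneg fun Y => hsup0 _
  have hn0 : (0 : ℝ) < n := by exact_mod_cast (by omega : 0 < n)
  have hδ : 0 < 1 - (m : ℝ) / n := by
    rw [sub_pos, div_lt_one hn0]; exact_mod_cast hmn
  suffices H : ∀ D, d m < D →
      σ (2 * n) ≤ Real.sqrt (2 * n) * γ⁻¹ * σ n ^ ((m : ℝ) / n) * D ^ (1 - (m : ℝ) / n) by
    have hcont : Continuous fun D : ℝ =>
        Real.sqrt (2 * n) * γ⁻¹ * σ n ^ ((m : ℝ) / n) * D ^ (1 - (m : ℝ) / n) :=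
      continuous_const.mul (Real.continuous_rpow_const hδ.le)
    exact ge_of_tendsto (hcont.continuousWithinAt (s := Set.Ioi (d m)))
      (Filter.eventually_of_mem self_mem_nhdsWithin H)
  intro D hdD
  have hD : 0 < D := hd0.trans_lt hdD
  have hroot (S : ℝ) (hS : 0 ≤ S) :
      (S ^ ((m : ℝ) / n) * D ^ (1 - (m : ℝ) / n)) ^ n = S ^ m * D ^ (n - m) := by
    rw [mul_pow, ← Real.rpow_mul_natCast hS, ← Real.rpow_mul_natCast hD.le,
      div_mul_cancel₀ _ hn0.ne', sub_mul, div_mul_cancel₀ _ hn0.ne', one_mul, Real.rpow_natCast,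
      ← Nat.cast_sub hmn.le, Real.rpow_natCast]
  rcases le_total (σ n) D with hσD | hDσ
  · have h1 : 1 ≤ Real.sqrt (2 * n) * γ⁻¹ := by
      refine one_le_mul_of_one_le_of_one_le (Real.one_le_sqrt.2 ?_) ((one_le_inv₀ hγ0).2 hγ1)
      have : (2 : ℝ) ≤ n := by exact_mod_cast hn
      linarith
    have h2 : σ n ≤ σ n ^ ((m : ℝ) / n) * D ^ (1 - (m : ℝ) / n) := by
      have := hσ0 n
      refine le_of_pow_le_pow_left₀ (n := n) (by omega) (by positivity) ?_
      rw [hroot _ this, ← Nat.add_sub_cancel' hmn.le, pow_add, Nat.add_sub_cancel' hmn.le]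
      gcongr
    rw [mul_assoc]
    exact (hσanti (by omega : n ≤ 2 * n)).trans
      (h2.trans (le_mul_of_one_le_left ((hσ0 n).trans h2) h1))
  · have : Nonempty {Y : Submodule ℝ X // FiniteDimensional ℝ Y ∧ Module.finrank ℝ Y ≤ m} :=
      ⟨⊥, inferInstance, by simp⟩
    rw [hd m] at hdD
    obtain ⟨⟨Y, hYf, hYm⟩, hYD⟩ := exists_lt_of_ciInf_lt hdD
    have key := prod_infDist_sq_le_of_near_subspace hmn.le (fun j : Fin n => f (n + j))
      (fun i : Fin n => span ℝ (f '' Set.Iio (n + i)))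
      (fun i j hij => subset_span ⟨n + j, by simpa using hij, rfl⟩) Y hYm hD hDσ
      (fun i j => (hσle _ (hfF _)).trans (hσanti (by omega)))
      (fun j => by
        obtain ⟨y, hy, hyD⟩ := (infDist_lt_iff ⟨0, Y.zero_mem⟩).1
          ((hle Y (hfF (n + j))).trans_lt hYD)
        exact ⟨y, hy, by rw [← dist_eq_norm]; exact hyD.le⟩)
    have hlow : (γ * σ (2 * n)) ^ n ≤
        ∏ i : Fin n, infDist (f (n + i)) (span ℝ (f '' Set.Iio (n + i)) : Set X) := by
      have := hσ0 (2 * n)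
      calc (γ * σ (2 * n)) ^ n = ∏ _i : Fin n, γ * σ (2 * n) := by simp
        _ ≤ _ := Finset.prod_le_prod (fun _ _ => by positivity) fun i _ =>
          (mul_le_mul_of_nonneg_left (hσanti (by omega)) hγ0.le).trans (hgreedy _)
    have h2n := hσ0 (2 * n)
    have hσn := hσ0 n
    have hmain : γ * σ (2 * n) ≤
        Real.sqrt (2 * n) * (σ n ^ ((m : ℝ) / n) * D ^ (1 - (m : ℝ) / n)) := by
      refine le_of_pow_le_pow_left₀ (n := n * 2) (by omega) (by positivity) ?_
      rw [mul_pow (Real.sqrt _), pow_mul, pow_mul (_ * _), hroot _ hσn, mul_comm n 2, pow_mul,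
        Real.sq_sqrt (by positivity)]
      exact (pow_le_pow_left₀ (by positivity) hlow 2).trans key
    calc σ (2 * n) = γ⁻¹ * (γ * σ (2 * n)) := by rw [inv_mul_cancel_left₀ hγ0.ne']
      _ ≤ γ⁻¹ * (Real.sqrt (2 * n) * (σ n ^ ((m : ℝ) / n) * D ^ (1 - (m : ℝ) / n))) := by gcongr
      _ = _ := by ring
end

section
/- Let α > 0, C_0 > 0 and c_0 > 0. If d_n ≤ C_0 · e^{−c_0 n^{α}} for all n ≥ 1, then σ_n ≤ √(2 C_0) · γ^{−1} · √n · e^{−c_1 n^{α}} for all n ≥ 2, where c_1 := 2^{−1−2α} · c_0. -/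
open Metric Submodule

/-- **Hadamard's inequality** for the rows of a real square matrix. -/
theorem det_sq_le_prod_sum_sq {n : ℕ} (M : Matrix (Fin n) (Fin n) ℝ) :
    M.det ^ 2 ≤ ∏ i, ∑ j, M i j ^ 2 := by
  have : Fact (Module.finrank ℝ (EuclideanSpace ℝ (Fin n)) = n) := ⟨by simp⟩
  let b := EuclideanSpace.basisFun (Fin n) ℝ
  have h := b.toBasis.orientation.abs_volumeForm_apply_le fun i => WithLp.toLp 2 (M i)
  rw [b.toBasis.orientation.volumeForm_robust b rfl, Module.Basis.det_apply] at h
  have hM : b.toBasis.toMatrix (fun i => WithLp.toLp 2 (M i)) = M.transpose := by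
    ext i j
    simp [b, Module.Basis.toMatrix_apply]
  rw [hM, Matrix.det_transpose] at h
  calc M.det ^ 2 = |M.det| ^ 2 := (sq_abs _).symm
    _ ≤ (∏ i, ‖WithLp.toLp 2 (M i)‖) ^ 2 := by gcongr
    _ = ∏ i, ∑ j, M i j ^ 2 := by
      rw [← Finset.prod_pow]
      simp [EuclideanSpace.norm_sq_eq]

/-- The AM-GM inequality with a bound on the sum. -/
theorem prod_le_div_pow_of_sum_le {m : ℕ} (hm : m ≠ 0) {x : Fin m → ℝ} (hx : ∀ i, 0 ≤ x i)
    {A : ℝ} (hA : ∑ i, x i ≤ A) : ∏ i, x i ≤ (A / m) ^ m := by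
  have hm' : (0 : ℝ) < m := by exact_mod_cast Nat.pos_of_ne_zero hm
  have h := Real.geom_mean_le_arith_mean Finset.univ (fun _ => 1) x (by simp) (by simpa using hm')
    fun i _ => hx i
  simp only [Real.rpow_one, Finset.sum_const, Finset.card_univ, Fintype.card_fin, nsmul_eq_mul,
    mul_one, one_mul] at h
  have hp : 0 ≤ ∏ i, x i := Finset.prod_nonneg fun i _ => hx i
  calc ∏ i, x i = ((∏ i, x i) ^ (m : ℝ)⁻¹) ^ m := (Real.rpow_inv_natCast_pow hp hm).symm
    _ ≤ (A / m) ^ m := by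
      gcongr
      exact h.trans (by gcongr)

/-- A determinant is small if its rows are close to a subspace of half the dimension. -/
theorem det_sq_le_of_near_subspace {l : ℕ} (hl : l ≠ 0)
    (g h : Fin (l + l) → EuclideanSpace ℝ (Fin (l + l)))
    (W : Submodule ℝ (EuclideanSpace ℝ (Fin (l + l)))) (hW : Module.finrank ℝ W ≤ l)
    (hh : ∀ i, h i ∈ W) {A B : ℝ} (hA : ∑ i, ‖g i‖ ^ 2 ≤ A) (hB : ∑ i, ‖g i - h i‖ ^ 2 ≤ B) :
    (Matrix.of fun i j => g i j).det ^ 2 ≤ (A / l) ^ l * (B / l) ^ l := by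
  let w := stdOrthonormalBasis ℝ W
  let v : Fin (l + l) → EuclideanSpace ℝ (Fin (l + l)) := fun i =>
    if hi : (i : ℕ) < Module.finrank ℝ W then (w ⟨i, hi⟩ : EuclideanSpace ℝ (Fin (l + l))) else 0
  let s : Set (Fin (l + l)) := {i | (i : ℕ) < Module.finrank ℝ W}
  have hv : Orthonormal ℝ (s.domRestrict v) := by
    have hw : Orthonormal ℝ fun i => (w i : EuclideanSpace ℝ (Fin (l + l))) :=
      w.orthonormal.comp_linearIsometry W.subtypeₗᵢ
    have : s.domRestrict v = (fun i => (w i : EuclideanSpace ℝ (Fin (l + l)))) ∘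
        fun i : s => (⟨(i : Fin (l + l)), i.2⟩ : Fin (Module.finrank ℝ W)) := by
      funext i
      have hi : ((i : Fin (l + l)) : ℕ) < Module.finrank ℝ W := i.2
      simp [v, hi]
    rw [this]
    refine hw.comp _ fun i j hij => ?_
    simpa [Fin.ext_iff, Subtype.ext_iff] using hij
  obtain ⟨b, hb⟩ := hv.exists_orthonormalBasis_extension_of_card_eq (by simp)
  have hbW : ∀ (p : Fin l) (x), x ∈ W → inner ℝ (b (Fin.natAdd l p)) x = 0 := by
    intro p x hx
    have hx' : x = ∑ k, (w.repr ⟨x, hx⟩ k) • (w k : EuclideanSpace ℝ (Fin (l + l))) := by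
      have := congrArg Subtype.val (w.sum_repr ⟨x, hx⟩)
      simpa using this.symm
    rw [hx', inner_sum]
    refine Finset.sum_eq_zero fun k _ => ?_
    have hk : (k : ℕ) < l + l := by omega
    have hkb : b ⟨k, hk⟩ = w k := by
      rw [hb ⟨k, hk⟩ k.2]
      simp [v]
    rw [inner_smul_right, ← hkb, b.orthonormal.inner_eq_zero, mul_zero]
    simp only [ne_eq, Fin.ext_iff, Fin.val_natAdd]
    omega
  let M : Matrix (Fin (l + l)) (Fin (l + l)) ℝ := Matrix.of fun p i => inner ℝ (b p) (g i)
  let Q : Matrix (Fin (l + l)) (Fin (l + l)) ℝ := Matrix.of fun p k => b p k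
  have hQ : Q.det ^ 2 = 1 := by
    have : Q * Q.transpose = 1 := by
      ext p q
      have := orthonormal_iff_ite.mp b.orthonormal q p
      simp only [PiLp.inner_apply, RCLike.inner_apply, conj_trivial] at this
      simp [Matrix.mul_apply, Q, Matrix.one_apply, this, eq_comm]
    have h := congrArg Matrix.det this
    rwa [Matrix.det_mul, Matrix.det_transpose, Matrix.det_one, ← sq] at h
  have hM : M = Q * (Matrix.of fun i j => g i j).transpose := by
    ext p i
    simp [M, Q, Matrix.mul_apply, PiLp.inner_apply, mul_comm]
  have hdet : (Matrix.of fun i j => g i j).det ^ 2 = M.det ^ 2 := by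
    rw [hM, Matrix.det_mul, Matrix.det_transpose, mul_pow, hQ, one_mul]
  rw [hdet]
  refine (det_sq_le_prod_sum_sq M).trans ?_
  rw [Fin.prod_univ_add]
  have bessel : ∀ x : EuclideanSpace ℝ (Fin (l + l)),
      ∑ p : Fin l, inner ℝ (b (Fin.castAdd l p)) x ^ 2 +
        ∑ p : Fin l, inner ℝ (b (Fin.natAdd l p)) x ^ 2 = ‖x‖ ^ 2 := by
    intro x
    rw [← b.sum_sq_norm_inner_right x, Fin.sum_univ_add]
    simp
  refine mul_le_mul
    (prod_le_div_pow_of_sum_le hl (fun _ => Finset.sum_nonneg fun _ _ => sq_nonneg _) ?_)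
    (prod_le_div_pow_of_sum_le hl (fun _ => Finset.sum_nonneg fun _ _ => sq_nonneg _) ?_)
    (Finset.prod_nonneg fun _ _ => Finset.sum_nonneg fun _ _ => sq_nonneg _) ?_
  · rw [Finset.sum_comm]
    refine le_trans (Finset.sum_le_sum fun i _ => ?_) hA
    rw [← bessel]
    exact le_add_of_nonneg_right (Finset.sum_nonneg fun _ _ => sq_nonneg _)
  · rw [Finset.sum_comm]
    refine le_trans (Finset.sum_le_sum fun i _ => ?_) hB
    rw [← bessel]
    refine le_add_of_nonneg_of_le (Finset.sum_nonneg fun _ _ => sq_nonneg _) (le_of_eq ?_)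
    refine Finset.sum_congr rfl fun p _ => ?_
    rw [inner_sub_right, hbW p _ (hh i), sub_zero]
    rfl
  · have : 0 ≤ A := le_trans (Finset.sum_nonneg fun _ _ => sq_nonneg _) hA
    positivity

/-- Hahn-Banach: the distance from a vector to a subspace is attained by a functional of norm at
most one that vanishes on the subspace. -/
theorem exists_dual_eq_infDist {X : Type*} [NormedAddCommGroup X] [NormedSpace ℝ X]
    (V : Submodule ℝ X) (x : X) :
    ∃ φ : StrongDual ℝ X, (∀ y, |φ y| ≤ ‖y‖) ∧ (∀ y ∈ V, φ y = 0) ∧ φ x = infDist x V := by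
  obtain ⟨ψ, hψ, hψx⟩ := exists_dual_vector'' ℝ (V.mkQ x)
  have hmk : ∀ y, ‖V.mkQ y‖ = infDist y V := fun y =>
    QuotientAddGroup.norm_mk (S := V.toAddSubgroup) y
  have hmk_le : ∀ y, ‖V.mkQ y‖ ≤ ‖y‖ := fun y => by
    rw [hmk]
    simpa using infDist_le_dist_of_mem (x := y) V.zero_mem
  have hbound : ∀ y, ‖(ψ.toLinearMap ∘ₗ V.mkQ) y‖ ≤ 1 * ‖y‖ := fun y =>
    (ψ.le_opNorm _).trans (mul_le_mul hψ (hmk_le y) (norm_nonneg _) zero_le_one)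
  refine ⟨(ψ.toLinearMap ∘ₗ V.mkQ).mkContinuous 1 hbound, fun y => ?_, fun y hy => ?_, ?_⟩
  · simpa using hbound y
  · have : V.mkQ y = 0 := by simpa using hy
    simp only [LinearMap.mkContinuous_apply, LinearMap.comp_apply, this, map_zero]
  · rw [← hmk]
    exact hψx

/-- If each of `2 * l` vectors of the unit ball is at distance at least `s` from the span of its
predecessors, while all are closer than `δ` to a space of dimension at most `l`, then
`s ^ 2 ≤ 4 * l * δ`. -/
theorem sq_le_of_infDist_span_of_infDist_lt {X : Type*} [NormedAddCommGroup X] [NormedSpace ℝ X]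
    {l : ℕ} (hl : l ≠ 0) {f : ℕ → X} (hf : ∀ n, ‖f n‖ ≤ 1) {s δ : ℝ} (hs : 0 ≤ s)
    (hsep : ∀ i < l + l, s ≤ infDist (f i) (span ℝ (f '' Set.Iio i) : Submodule ℝ X))
    (Y : Submodule ℝ X) [FiniteDimensional ℝ Y] (hY : Module.finrank ℝ Y ≤ l)
    (hnear : ∀ i, infDist (f i) Y < δ) : s ^ 2 ≤ 4 * l * δ := by
  have hδ : 0 ≤ δ := infDist_nonneg.trans (hnear 0).le
  choose φ hφ hφV hφf using fun i => exists_dual_eq_infDist (span ℝ (f '' Set.Iio i)) (f i)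
  choose y hyY hy using fun i => (infDist_lt_iff ⟨0, Y.zero_mem⟩).mp (hnear i)
  let Φ : X →ₗ[ℝ] EuclideanSpace ℝ (Fin (l + l)) :=
    (WithLp.linearEquiv 2 ℝ (Fin (l + l) → ℝ)).symm.toLinearMap ∘ₗ
      LinearMap.pi fun j : Fin (l + l) => (φ j).toLinearMap
  have hΦ : ∀ x j, Φ x j = φ j x := fun x j => rfl
  have hΦn : ∀ x c, ‖x‖ ≤ c → ‖Φ x‖ ^ 2 ≤ (l + l) * c ^ 2 := by
    intro x c hx
    rw [EuclideanSpace.norm_sq_eq]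
    refine (Finset.sum_le_card_nsmul _ _ (c ^ 2) fun j _ => ?_).trans_eq (by simp)
    rw [hΦ, Real.norm_eq_abs]
    gcongr
    exact (hφ _ x).trans hx
  have hsum : ∀ (z : Fin (l + l) → X) c, (∀ i, ‖z i‖ ≤ c) →
      ∑ i, ‖Φ (z i)‖ ^ 2 ≤ (l + l) * ((l + l) * c ^ 2) := fun z c hz =>
    (Finset.sum_le_card_nsmul _ _ _ fun i _ => hΦn _ _ (hz i)).trans_eq (by simp)
  have hdist := hsum (fun i => f i - y i) δ fun i => by simpa [dist_eq_norm] using (hy i).le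
  simp only [map_sub] at hdist
  have hdet := det_sq_le_of_near_subspace hl (fun i => Φ (f i)) (fun i => Φ (y i)) (Y.map Φ)
    ((finrank_map_le Φ Y).trans hY) (fun i => mem_map_of_mem (hyY i))
    (hsum (fun i => f i) 1 fun i => hf i) hdist
  rw [Matrix.det_of_isLowerTriangular] at hdet
  · have hlow : s ^ (l + l) ≤ ∏ i, Matrix.of (fun (i : Fin (l + l)) j => Φ (f i) j) i i := by
      rw [← Fin.prod_const]
      refine Finset.prod_le_prod (fun _ _ => hs) fun i _ => ?_
      rw [Matrix.of_apply, hΦ, hφf]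
      exact hsep i i.2
    have hl' : (l : ℝ) ≠ 0 := by exact_mod_cast hl
    have hpow : (s ^ 2) ^ (l + l) ≤ (4 * l * δ) ^ (l + l) := by
      calc (s ^ 2) ^ (l + l) = (s ^ (l + l)) ^ 2 := by ring
        _ ≤ _ := by gcongr
        _ ≤ _ := hdet
        _ = (4 * l * δ) ^ (l + l) := by
          rw [← mul_pow, pow_add, ← mul_pow]
          congr 1
          field_simp
          ring
    exact le_of_pow_le_pow_left₀ (by omega) (by positivity) hpow
  · intro i j hij
    rw [Matrix.of_apply, hΦ]
    exact hφV _ _ (subset_span ⟨i, hij, rfl⟩)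

/-- Corollary 4.2 (iii): sub-exponential decay of widths implies sub-exponential decay of greedy errors, up to a factor `√n`. -/
theorem weak_greedy_banach_subexp
    {X : Type*} [NormedAddCommGroup X] [NormedSpace ℝ X] [CompleteSpace X]
    (γ : ℝ) (hγ0 : 0 < γ) (hγ1 : γ ≤ 1)
    (F : Set X) (hFc : IsCompact F) (hFb : ∀ g ∈ F, ‖g‖ ≤ 1)
    (f : ℕ → X) (hfF : ∀ n, f n ∈ F)
    (σ : ℕ → ℝ)
    (hσ : ∀ n, σ n =
      sSup ((fun g => infDist g ((span ℝ (f '' Set.Iio n) : Submodule ℝ X) : Set X)) '' F))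
    (hgreedy : ∀ n, γ * σ n ≤
      infDist (f n) ((span ℝ (f '' Set.Iio n) : Submodule ℝ X) : Set X))
    (d : ℕ → ℝ)
    (hd : ∀ m, d m =
      ⨅ Y : {Y : Submodule ℝ X // FiniteDimensional ℝ Y ∧ Module.finrank ℝ Y ≤ m},
        sSup ((fun g => infDist g ((Y : Submodule ℝ X) : Set X)) '' F))
    (α C₀ c₀ : ℝ) (hα : 0 < α) (hC₀ : 0 < C₀) (hc₀ : 0 < c₀)
    (hdecay : ∀ n : ℕ, 1 ≤ n → d n ≤ C₀ * Real.exp (-c₀ * (n : ℝ) ^ α)) :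
    ∀ n : ℕ, 2 ≤ n →
      σ n ≤ Real.sqrt (2 * C₀) * γ⁻¹ * Real.sqrt n *
        Real.exp (-((2 : ℝ) ^ (-1 - 2 * α) * c₀) * (n : ℝ) ^ α) := by
  have hbdd : ∀ Y : Submodule ℝ X, BddAbove ((fun g => infDist g (Y : Set X)) '' F) := by
    rintro Y
    refine ⟨1, ?_⟩
    rintro _ ⟨g, hg, rfl⟩
    refine le_trans ?_ (hFb g hg)
    simpa using infDist_le_dist_of_mem (x := g) Y.zero_mem
  have hanti : ∀ i n, i ≤ n → σ n ≤ σ i := by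
    intro i n hin
    rw [hσ n, hσ i]
    refine csSup_le ⟨_, f 0, hfF 0, rfl⟩ ?_
    rintro _ ⟨g, hg, rfl⟩
    refine le_trans ?_ (le_csSup (hbdd _) ⟨g, hg, rfl⟩)
    exact infDist_le_infDist_of_subset
      (span_mono (Set.image_mono (Set.Iio_subset_Iio hin))) ⟨0, zero_mem _⟩
  have hσ0 : ∀ n, 0 ≤ σ n := by
    intro n
    rw [hσ n]
    exact Real.sSup_nonneg (by rintro _ ⟨g, -, rfl⟩; exact infDist_nonneg)
  have hwidth : ∀ l : ℕ, l ≠ 0 → (γ * σ (l + l)) ^ 2 ≤ 4 * l * d l := by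
    intro l hl
    have hl' : (0 : ℝ) < 4 * l := by
      have : (0 : ℝ) < l := by exact_mod_cast Nat.pos_of_ne_zero hl
      positivity
    rw [← div_le_iff₀' hl']
    refine le_of_forall_gt_imp_ge_of_dense fun δ hδ => ?_
    rw [div_le_iff₀' hl']
    have : Nonempty {Y : Submodule ℝ X // FiniteDimensional ℝ Y ∧ Module.finrank ℝ Y ≤ l} :=
      ⟨⊥, inferInstance, by simp⟩
    rw [hd] at hδ
    obtain ⟨⟨Y, hYfin, hYl⟩, hY⟩ := exists_lt_of_ciInf_lt hδ
    refine sq_le_of_infDist_span_of_infDist_lt hl (fun n => hFb _ (hfF n))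
      (mul_nonneg hγ0.le (hσ0 _)) (fun i hi => ?_) Y hYl fun i => ?_
    · exact (mul_le_mul_of_nonneg_left (hanti _ _ hi.le) hγ0.le).trans (hgreedy i)
    · exact (le_csSup (hbdd Y) ⟨f i, hfF i, rfl⟩).trans_lt hY
  intro n hn
  obtain ⟨l, hl1, hl2, hl4⟩ : ∃ l : ℕ, 1 ≤ l ∧ l + l ≤ n ∧ n ≤ 4 * l :=
    ⟨n / 2, by omega, by omega, by omega⟩
  have hl2' : (l : ℝ) + l ≤ n := by exact_mod_cast hl2
  have hl4' : (n : ℝ) ≤ 4 * l := by exact_mod_cast hl4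
  have hpow : (2 : ℝ) ^ (-(2 * α)) * (n : ℝ) ^ α ≤ (l : ℝ) ^ α := by
    have h4 : (2 : ℝ) ^ (2 * α) = 4 ^ α := by
      rw [Real.rpow_mul (by norm_num)]
      norm_num
    rw [Real.rpow_neg (by norm_num), h4, inv_mul_le_iff₀ (by positivity),
      ← Real.mul_rpow (by norm_num) (by positivity)]
    gcongr
  have hc : 2 * (2 : ℝ) ^ (-1 - 2 * α) = 2 ^ (-(2 * α)) := by
    rw [show -1 - 2 * α = -(2 * α) - 1 by ring, Real.rpow_sub_one (by norm_num)]
    ring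
  have key : (γ * σ n) ^ 2 ≤ 2 * C₀ * n * Real.exp (-((2 : ℝ) ^ (-(2 * α)) * c₀) * (n : ℝ) ^ α) :=
    calc (γ * σ n) ^ 2 ≤ (γ * σ (l + l)) ^ 2 := by
          have := hσ0 n
          gcongr
          exact hanti _ _ hl2
      _ ≤ 4 * l * d l := hwidth l (by omega)
      _ ≤ 4 * l * (C₀ * Real.exp (-c₀ * (l : ℝ) ^ α)) := by
          gcongr
          exact hdecay l hl1
      _ = 2 * C₀ * (l + l) * Real.exp (-c₀ * (l : ℝ) ^ α) := by ring
      _ ≤ _ := by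
          gcongr 2 * C₀ * ?_ * Real.exp ?_
          nlinarith [mul_le_mul_of_nonneg_left hpow hc₀.le]
  rw [← hc] at key
  have hrhs : 2 * C₀ * n * Real.exp (-(2 * (2 : ℝ) ^ (-1 - 2 * α) * c₀) * (n : ℝ) ^ α) =
      (√(2 * C₀) * √n * Real.exp (-((2 : ℝ) ^ (-1 - 2 * α) * c₀) * (n : ℝ) ^ α)) ^ 2 := by
    rw [mul_pow, mul_pow, Real.sq_sqrt (by positivity), Real.sq_sqrt (by positivity),
      ← Real.exp_nat_mul]
    congr 2
    push_cast
    ring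
  rw [hrhs] at key
  have h := le_of_sq_le_sq key (by positivity)
  rw [← le_inv_mul_iff₀ hγ0] at h
  exact h.trans_eq (by ring)
end

section
/- Let (x_j)_{j≥0} be a nonincreasing sequence of positive reals converging to 0, let f_j := x_j e_j ∈ ℓ∞(ℕ), where e_j is the j-th standard coordinate sequence, and let F := {f_j : j ≥ 0} ∪ {0}. Then F is a compact subset of ℓ∞(ℕ), and for every n ≥ 0 one has dist(f_n, span{f_0, …, f_{n−1}}) = x_n = sup_{f ∈ F} dist(f, span{f_0, …, f_{n−1}}), where distances are taken in the sup norm; in particular, the sequence (f_n)_{n≥0} is a valid realization of the greedy algorithm (γ = 1) on F and its greedy errors are σ_n = x_n. -/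
open Metric Submodule ENNReal

theorem lp_top_norm_smul_single {c : ℝ} (hc : 0 ≤ c) (j : ℕ) :
    ‖(c • lp.single ∞ j (1 : ℝ) : lp (fun _ : ℕ => ℝ) ∞)‖ = c := by
  rw [norm_smul, lp.norm_single (by simp)]
  simp [abs_of_nonneg hc]

theorem infDist_le_norm_of_submodule {E : Type*} [NormedAddCommGroup E] [NormedSpace ℝ E]
    (S : Submodule ℝ E) (g : E) : infDist g (S : Set E) ≤ ‖g‖ := by
  simpa using infDist_le_dist_of_mem (x := g) S.zero_mem

theorem apply_eq_zero_of_mem_span {f : ℕ → lp (fun _ : ℕ => ℝ) ∞} {s : Set ℕ} {n : ℕ}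
    (h : ∀ j ∈ s, f j n = 0) {g : lp (fun _ : ℕ => ℝ) ∞} (hg : g ∈ span ℝ (f '' s)) :
    g n = 0 := by
  induction hg using Submodule.span_induction with
  | mem g hg =>
    obtain ⟨j, hj, rfl⟩ := hg
    exact h j hj
  | zero => rfl
  | add a b _ _ ha hb => simp [ha, hb]
  | smul c a _ ha => simp [ha]

/-- Section 5, first example: for a nonincreasing positive sequence `x_j → 0` and
`f_j = x_j e_j` in `ℓ∞(ℕ)`, the set `F = {f_j : j ≥ 0} ∪ {0}` is compact, and the
greedy algorithm (γ = 1) can choose the `f_j` in order, with greedy errors `σ_n = x_n`. -/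
theorem greedy_linf_example
    (x : ℕ → ℝ) (hxpos : ∀ j, 0 < x j) (hmono : ∀ j, x (j + 1) ≤ x j)
    (hlim : Filter.Tendsto x Filter.atTop (nhds 0))
    (f : ℕ → lp (fun _ : ℕ => ℝ) ∞)
    (hf : ∀ j, f j = x j • lp.single ∞ j (1 : ℝ))
    (F : Set (lp (fun _ : ℕ => ℝ) ∞)) (hF : F = Set.range f ∪ {0}) :
    IsCompact F ∧
      ∀ n : ℕ,
        infDist (f n) ((span ℝ (f '' Set.Iio n) : Submodule ℝ (lp (fun _ : ℕ => ℝ) ∞)) : Set _)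
            = x n ∧
        x n = sSup ((fun g => infDist g
            ((span ℝ (f '' Set.Iio n) : Submodule ℝ (lp (fun _ : ℕ => ℝ) ∞)) : Set _)) '' F) := by
  have hnorm (j : ℕ) : ‖f j‖ = x j := by
    rw [hf, lp_top_norm_smul_single (hxpos j).le]
  have hanti : Antitone x := antitone_nat_of_succ_le hmono
  have hdist (n : ℕ) : infDist (f n)
      ((span ℝ (f '' Set.Iio n) : Submodule ℝ (lp (fun _ : ℕ => ℝ) ∞)) : Set _) = x n := by
    refine le_antisymm ((infDist_le_norm_of_submodule _ _).trans_eq (hnorm n)) ?_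
    rw [le_infDist ⟨0, zero_mem _⟩]
    intro g hg
    have hgn : g n = 0 := by
      refine apply_eq_zero_of_mem_span (fun j hj => ?_) hg
      simp [hf, (Set.mem_Iio.mp hj).ne']
    calc
      x n = ‖(f n - g) n‖ := by
        rw [lp.coeFn_sub, Pi.sub_apply, hgn, hf]
        simp [abs_of_pos (hxpos n)]
      _ ≤ ‖f n - g‖ := lp.norm_apply_le_norm (by simp) _ _
      _ = dist (f n) g := (dist_eq_norm _ _).symm
  subst hF
  refine ⟨?_, fun n => ⟨hdist n, (IsGreatest.csSup_eq ⟨?_, ?_⟩).symm⟩⟩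
  · have hf0 : Filter.Tendsto f Filter.atTop (nhds 0) := by
      rw [tendsto_zero_iff_norm_tendsto_zero]
      simpa only [hnorm] using hlim
    rw [Set.union_singleton]
    exact hf0.isCompact_insert_range
  · exact ⟨f n, Or.inl ⟨n, rfl⟩, hdist n⟩
  · rintro _ ⟨_, ⟨j, rfl⟩ | rfl, rfl⟩
    · rcases lt_or_ge j n with hj | hj
      · have hmem : f j ∈ span ℝ (f '' Set.Iio n) := subset_span (Set.mem_image_of_mem f hj)
        have h0 := infDist_zero_of_mem (SetLike.mem_coe.mpr hmem)
        exact h0.trans_le (hxpos n).le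
      · have hle := infDist_le_norm_of_submodule (span ℝ (f '' Set.Iio n)) (f j)
        exact hle.trans ((hnorm j).trans_le (hanti hj))
    · have hle := infDist_le_norm_of_submodule (span ℝ (f '' Set.Iio n)) 0
      rw [norm_zero] at hle
      exact hle.trans (hxpos n).le
end
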